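/- For every n and every x ∈ 2^n: I(x;H) ≥ k_x − 2 log k_x − O(1), i.e. the information that x carries about the Halting sequence is at least the m-depth of x minus a logarithmic term. -/

import Mathlib

open scoped BigOperators
open scoped Classical

/-- The standard bijection between natural numbers and finite binary strings
(`ε ↦ 0`, `0 ↦ 1`, `1 ↦ 2`, `00 ↦ 3`, ...), inverse direction. -/
def strOfNat (n : ℕ) : List Bool := (n + 1).bits.dropLast

/-- Base-2 tetration: `1, 2, 2^2, 2^(2^2), ...`. -/
def tetr : ℕ → ℕ
  | 0 => 1
  | k + 1 => 2 ^ tetr k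

/-- The super-logarithm, the inverse of base-2 tetration. -/
noncomputable def slog (x : ℕ) : ℕ := sSup {k | tetr k ≤ x}

noncomputable section

/-- A machine given by a computable, monotone (in time) stepwise evaluation function
`step t p y n` : time `t`, program `p`, condition `y`, length parameter `n`
(the length parameter is always available). -/
structure Machine where
  step : ℕ → List Bool → ℕ → ℕ → Option ℕ
  computable_step :
    Computable fun q : (ℕ × List Bool) × ℕ × ℕ => step q.1.1 q.1.2 q.2.1 q.2.2
  mono : ∀ {t t' : ℕ} {p : List Bool} {y n v : ℕ}, t ≤ t' →
      step t p y n = some v → step t' p y n = some v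

namespace Machine

variable (M : Machine)

/-- `M(p|y,n) ↓ = v`. -/
def Outputs (p : List Bool) (y n v : ℕ) : Prop := ∃ t, M.step t p y n = some v

/-- `M(p|y,n) ↓`. -/
def HaltsOn (p : List Bool) (y n : ℕ) : Prop := ∃ v, M.Outputs p y n v

/-- the domain of `M` is prefix-free (for every condition). -/
def PrefixFree : Prop :=
  ∀ {p q : List Bool} {y n : ℕ}, M.HaltsOn p y n → M.HaltsOn q y n → p <+: q → p = q

/-- Kolmogorov complexity with respect to `M` (prefix-free complexity `K` when `M` is an
optimal prefix-free interpreter, plain complexity `C` when `M` is an optimal plain machine). -/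
def C (x y n : ℕ) : ℕ := sInf {l | ∃ p : List Bool, p.length = l ∧ M.Outputs p y n x}

/-- Time-bounded Kolmogorov complexity (`⊤` if no program produces `x` within time `t`). -/
def Ct (t x y n : ℕ) : ℕ∞ :=
  sInf {l : ℕ∞ | ∃ p : List Bool, (p.length : ℕ∞) = l ∧ M.step t p y n = some x}

/-- every value has a program, for every condition. -/
def Total : Prop := ∀ x y n, ∃ p : List Bool, M.Outputs p y n x

/-- `M` is an optimal universal prefix-free interpreter. -/
def POptimal : Prop := M.PrefixFree ∧ M.Total ∧
  ∀ N : Machine, N.PrefixFree → ∃ c, ∀ (p : List Bool) (y n v : ℕ),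
    N.Outputs p y n v → M.C v y n ≤ p.length + c

/-- `M` is an optimal universal plain machine. -/
def Optimal : Prop := M.Total ∧
  ∀ N : Machine, ∃ c, ∀ (p : List Bool) (y n v : ℕ),
    N.Outputs p y n v → M.C v y n ≤ p.length + c

/-- `p` is a shortest program for `x` (given `y`, `n`) on `M`. -/
def ShortestProg (p : List Bool) (x y n : ℕ) : Prop :=
  M.Outputs p y n x ∧ p.length = M.C x y n

/-- `u → v`: some program of length at most `c` computes `v` from `u` (and `n`). -/
def Computes (c u n v : ℕ) : Prop := ∃ q : List Bool, q.length ≤ c ∧ M.Outputs q u n v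

/-- `Ω^n_t`. -/
def OmegaT (n t : ℕ) : ℝ :=
  ∑' p : List Bool,
    if ∃ v, v < 2 ^ n ∧ M.step t p 0 n = some v then (2 : ℝ) ^ (-(p.length : ℤ)) else 0

/-- `Ω^n`. -/
def Omega (n : ℕ) : ℝ :=
  ∑' p : List Bool,
    if ∃ v, v < 2 ^ n ∧ M.Outputs p 0 n v then (2 : ℝ) ^ (-(p.length : ℤ)) else 0

/-- `t_k = min { t : Ω^n − Ω^n_t ≤ 2^{−k} }`. -/
def tk (n k : ℕ) : ℕ := sInf {t | M.Omega n - M.OmegaT n t ≤ (2 : ℝ) ^ (-(k : ℤ))}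

/-- the computational `m`-depth `k_x` of `x ∈ 2^n`, with additive constant `d`:
`k_x = min { k : K_{t_k}(x) ≤ K(x) + d }`. -/
def mdepth (d n x : ℕ) : ℕ :=
  sInf {k | ∃ p : List Bool, p.length ≤ M.C x 0 n + d ∧ M.step (M.tk n k) p 0 n = some x}

/-- `Ω^{n,j}`: the first `j` bits of the binary expansion of `Ω^n`, as a natural number. -/
def OmegaBits (n j : ℕ) : ℕ := ⌊M.Omega n * 2 ^ j⌋₊

/-- `H^{n,j}`: the first `j` bits of the Halting sequence `H^n` of `M`, as a natural number. -/
def Hbits (n j : ℕ) : ℕ :=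
  ∑ i ∈ Finset.range j, if M.HaltsOn (strOfNat i) 0 n then 2 ^ i else 0

/-- The Busy Beaver function of `M`: `BB(k) = max { M(p) : p ∈ 2^k, M(p)↓ }`. -/
def BB (n k : ℕ) : ℕ := sSup {v | ∃ p : List Bool, p.length = k ∧ M.Outputs p 0 n v}

end Machine

/-- `p` is a program on `M` computing the rational-valued function `P`. -/
def ProgForProb (M : Machine) (p : List Bool) (P : ℕ → ℚ) (n : ℕ) : Prop :=
  ∀ y, M.Outputs p y n (Encodable.encode (P y))

/-- Complexity of the function `P` with respect to `M`. -/
noncomputable def KProb (M : Machine) (n : ℕ) (P : ℕ → ℚ) : ℕ :=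
  sInf {l | ∃ p : List Bool, p.length = l ∧ ProgForProb M p P n}

/-- a (length conditional) semimeasure on `2^n`. -/
def IsSemimeasure (n : ℕ) (P : ℕ → ℚ) : Prop :=
  (∀ y, 0 ≤ P y) ∧ ∑ y ∈ Finset.range (2 ^ n), P y ≤ 1

/-- `p` is a program on `M` computing the partial function `F` (on binary strings). -/
def ProgForFun (M : Machine) (p : List Bool) (F : List Bool → Option ℕ) (n : ℕ) : Prop :=
  ∀ d v, F d = some v ↔ M.Outputs p (Encodable.encode d) n v

/-- `F` has prefix-free domain. -/
def PrefixFreeFun (F : List Bool → Option ℕ) : Prop :=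
  ∀ d d', (F d).isSome → (F d').isSome → d <+: d' → d = d'

/-- Complexity of the partial function `F` with respect to `M`. -/
noncomputable def KFun (M : Machine) (n : ℕ) (F : List Bool → Option ℕ) : ℕ :=
  sInf {l | ∃ p : List Bool, p.length = l ∧ ProgForFun M p F n}

/-- sufficient set statistic: `x ∈ S` and `K(S) + log|S| = K(x) ± c`. -/
def SufficientSet (Φ : Machine) (c n x : ℕ) (S : Finset ℕ) : Prop :=
  x ∈ S ∧ S ⊆ Finset.range (2 ^ n) ∧
    Nat.dist (Φ.C (Encodable.encode S) 0 n + Nat.log 2 S.card) (Φ.C x 0 n) ≤ c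

/-- sufficient probabilistic statistic: `P` computable semimeasure, `K(P) − log P(x) = K(x) ± c`. -/
def SufficientProb (Φ : Machine) (c n x : ℕ) (P : ℕ → ℚ) : Prop :=
  IsSemimeasure n P ∧ (∃ p, ProgForProb Φ p P n) ∧
    |(KProb Φ n P : ℝ) - Real.logb 2 (P x) - (Φ.C x 0 n : ℝ)| ≤ c

/-- sufficient function statistic: `F` computable prefix-free,
`K(F) + l(d) = K(x) ± c` for some `d` with `F(d) = x`. -/
def SufficientFun (Φ : Machine) (c n x : ℕ) (F : List Bool → Option ℕ) : Prop :=
  PrefixFreeFun F ∧ (∃ p, ProgForFun Φ p F n) ∧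
    ∃ d, F d = some x ∧ Nat.dist (KFun Φ n F + d.length) (Φ.C x 0 n) ≤ c

/-- minimal sufficient set statistic (within the constant `c`). -/
def MinimalSufficientSet (Φ : Machine) (c n x : ℕ) (S : Finset ℕ) : Prop :=
  SufficientSet Φ c n x S ∧ ∀ S' : Finset ℕ, SufficientSet Φ c n x S' →
    Φ.C (Encodable.encode S) 0 n ≤ Φ.C (Encodable.encode S') 0 n + c

/-- `l^S_x`: the complexity of a minimal sufficient set statistic. -/
noncomputable def lSet (Φ : Machine) (c n x : ℕ) : ℕ :=
  sInf {l | ∃ S : Finset ℕ, SufficientSet Φ c n x S ∧ Φ.C (Encodable.encode S) 0 n = l}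

/-- `l^P_x`: the complexity of a minimal sufficient probabilistic statistic. -/
noncomputable def lProb (Φ : Machine) (c n x : ℕ) : ℕ :=
  sInf {l | ∃ P : ℕ → ℚ, SufficientProb Φ c n x P ∧ KProb Φ n P = l}

/-- `l^F_x`: the complexity of a minimal sufficient function statistic. -/
noncomputable def lFun (Φ : Machine) (c n x : ℕ) : ℕ :=
  sInf {l | ∃ F : List Bool → Option ℕ, SufficientFun Φ c n x F ∧ KFun Φ n F = l}

/-- weak sufficient set statistic: `C(S) + log|S| = K(x|C(S)) ± c`
(`Φ` the prefix-free interpreter, `Ψ` the plain machine). -/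
def WeakSufficientSet (Φ Ψ : Machine) (c n x : ℕ) (S : Finset ℕ) : Prop :=
  x ∈ S ∧ S ⊆ Finset.range (2 ^ n) ∧
    Nat.dist (Ψ.C (Encodable.encode S) 0 n + Nat.log 2 S.card)
      (Φ.C x (Ψ.C (Encodable.encode S) 0 n) n) ≤ c

/-- weak sufficient probabilistic statistic: `C(P) − log P(x) = K(x|C(P)) ± c`. -/
def WeakSufficientProb (Φ Ψ : Machine) (c n x : ℕ) (P : ℕ → ℚ) : Prop :=
  IsSemimeasure n P ∧ (∃ p, ProgForProb Ψ p P n) ∧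
    |(KProb Ψ n P : ℝ) - Real.logb 2 (P x) - (Φ.C x (KProb Ψ n P) n : ℝ)| ≤ c

/-- weak sufficient function statistic: `C(F) + l(d) = K(x|C(F)) ± c` for some `d`, `F(d) = x`. -/
def WeakSufficientFun (Φ Ψ : Machine) (c n x : ℕ) (F : List Bool → Option ℕ) : Prop :=
  (∃ p, ProgForFun Ψ p F n) ∧
    ∃ d, F d = some x ∧ Nat.dist (KFun Ψ n F + d.length) (Φ.C x (KFun Ψ n F) n) ≤ c

/-- typical semimeasure: `−log P(x) = K(x|P*) ± c`, `P*` a shortest plain description of `P`. -/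
def TypicalProb (Φ Ψ : Machine) (c n x : ℕ) (P : ℕ → ℚ) : Prop :=
  IsSemimeasure n P ∧ (∃ p, ProgForProb Ψ p P n) ∧
    ∀ p : List Bool, ProgForProb Ψ p P n → p.length = KProb Ψ n P →
      |(-Real.logb 2 (P x)) - (Φ.C x (Encodable.encode p) n : ℝ)| ≤ c

/-- the `BB`-depth `k'_x` with additive constant `d`:
`k'_x = min { k : K_{BB(k)}(x|k) ≤ K(x|k) + d }`. -/
noncomputable def kBB (Φ Ψ : Machine) (d n x : ℕ) : ℕ :=
  sInf {k | ∃ p : List Bool, p.length ≤ Φ.C x k n + d ∧ Φ.step (Ψ.BB n k) p k n = some x}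

/-- The explicit weak sufficient statistic `P'_x`, with constants `d` (for `k'_x`),
`c` (scaling) and `c₂` (difference threshold):
`P'_x(y) = 2^{−K_{BB(k'_x)}(y|k'_x) + k'_x − c}` when
`K_{BB(k'_x)}(y|k'_x)` and `K_{BB(k'_x−1)}(y|k'_x)` differ by more than `c₂`, else `0`. -/
noncomputable def Pprime (Φ Ψ : Machine) (d c c₂ n x : ℕ) (y : ℕ) : ℚ :=
  if Φ.Ct (Ψ.BB n (kBB Φ Ψ d n x)) y (kBB Φ Ψ d n x) n + (c₂ : ℕ∞) <
      Φ.Ct (Ψ.BB n (kBB Φ Ψ d n x - 1)) y (kBB Φ Ψ d n x) n then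
    (2 : ℚ) ^ (kBB Φ Ψ d n x) /
      2 ^ (c + (Φ.Ct (Ψ.BB n (kBB Φ Ψ d n x)) y (kBB Φ Ψ d n x) n).toNat)
  else 0

/-- A prefix-free oracle machine: `step t p y n w` where `w` is the length-`t` initial
segment of the oracle which may be queried within `t` steps. -/
structure OracleMachine where
  step : ℕ → List Bool → ℕ → ℕ → List Bool → Option ℕ
  computable_step :
    Computable fun q : ((ℕ × List Bool) × ℕ × ℕ) × List Bool =>
      step q.1.1.1 q.1.1.2 q.1.2.1 q.1.2.2 q.2
  mono : ∀ {t t' : ℕ} {p : List Bool} {y n v : ℕ} (O : ℕ → Bool), t ≤ t' →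
      step t p y n (List.ofFn fun i : Fin t => O i) = some v →
      step t' p y n (List.ofFn fun i : Fin t' => O i) = some v

namespace OracleMachine

variable (M : OracleMachine) (O : ℕ → Bool)

def Outputs (p : List Bool) (y n v : ℕ) : Prop :=
  ∃ t, M.step t p y n (List.ofFn fun i : Fin t => O i) = some v

def HaltsOn (p : List Bool) (y n : ℕ) : Prop := ∃ v, M.Outputs O p y n v

def PrefixFree : Prop :=
  ∀ {p q : List Bool} {y n : ℕ}, M.HaltsOn O p y n → M.HaltsOn O q y n → p <+: q → p = q

/-- oracle Kolmogorov complexity `K^O`. -/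
def C (x y n : ℕ) : ℕ := sInf {l | ∃ p : List Bool, p.length = l ∧ M.Outputs O p y n x}

def Total : Prop := ∀ x y n, ∃ p : List Bool, M.Outputs O p y n x

/-- `M` is an optimal universal prefix-free machine relative to the oracle `O`. -/
def POptimal : Prop := M.PrefixFree O ∧ M.Total O ∧
  ∀ N : OracleMachine, N.PrefixFree O → ∃ c, ∀ (p : List Bool) (y n v : ℕ),
    N.Outputs O p y n v → M.C O v y n ≤ p.length + c

end OracleMachine

/-- The Halting sequence of `Φ` as a single oracle (pairing index and length parameter). -/
noncomputable def Hseq (Φ : Machine) : ℕ → Bool :=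
  fun i => decide (Φ.HaltsOn (strOfNat i.unpair.1) 0 i.unpair.2)

end

/-- The bijective base-two numeral of a string, least significant digit first. -/
def num : List Bool → ℕ
  | [] => 1
  | b :: p => Nat.bit b (num p)

lemma num_pos (p : List Bool) : 0 < num p := by
  induction p with
  | nil => simp [num]
  | cons b p ih => cases b <;> simp [num, Nat.bit_val, ih]

lemma strOfNat_zero : strOfNat 0 = [] := by simp [strOfNat]

lemma strOfNat_succ (n : ℕ) : strOfNat (n + 1) = decide (n % 2 = 1) :: strOfNat (n / 2) := by
  have h : n + 1 + 1 = Nat.bit (decide (n % 2 = 1)) (n / 2 + 1) := by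
    rw [Nat.bit_val]
    rcases Nat.mod_two_eq_zero_or_one n with h | h <;> simp [h] <;> omega
  unfold strOfNat
  rw [h, Nat.bits_append_bit _ _ (by omega)]
  have : (n / 2 + 1).bits ≠ [] := by
    intro h0
    have := Nat.size_eq_bits_len (n / 2 + 1)
    have hp : 0 < (n / 2 + 1).size := Nat.size_pos.2 (by omega)
    rw [← this, h0] at hp
    simp at hp
  rw [List.dropLast_cons_of_ne_nil this]

lemma strOfNat_num_sub_one (p : List Bool) : strOfNat (num p - 1) = p := by
  induction p with
  | nil => simp [num, strOfNat]
  | cons b p ih =>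
    have hp := num_pos p
    have h : num (b :: p) - 1 = (2 * (num p - 1) + b.toNat) + 1 := by
      simp only [num, Nat.bit_val]; omega
    rw [h, strOfNat_succ]
    have h1 : (2 * (num p - 1) + b.toNat) / 2 = num p - 1 := by cases b <;> simp; omega
    have h2 : decide ((2 * (num p - 1) + b.toNat) % 2 = 1) = b := by cases b <;> simp
    rw [h1, h2, ih]

lemma num_strOfNat (n : ℕ) : num (strOfNat n) = n + 1 := by
  induction n using Nat.strong_induction_on with
  | _ n ih =>
    cases n with
    | zero => simp [strOfNat_zero, num]
    | succ n =>
      rw [strOfNat_succ, num, ih (n / 2) (by omega), Nat.bit_val]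
      rcases Nat.mod_two_eq_zero_or_one n with h | h <;> simp [h] <;> omega

/-- `strOfNat` as an equivalence. -/
def strEquiv : ℕ ≃ List Bool where
  toFun := strOfNat
  invFun p := num p - 1
  left_inv n := by simp [num_strOfNat]
  right_inv := strOfNat_num_sub_one

lemma strOfNat_injective : Function.Injective strOfNat := strEquiv.injective

lemma two_pow_length_le_num (p : List Bool) : 2 ^ p.length ≤ num p := by
  induction p with
  | nil => simp [num]
  | cons b p ih => simp only [num, Nat.bit_val, List.length_cons, pow_succ]; omega

lemma num_lt_two_pow (p : List Bool) : num p < 2 ^ (p.length + 1) := by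
  induction p with
  | nil => simp [num]
  | cons b p ih =>
    have := Bool.toNat_le b
    simp only [num, Nat.bit_val, List.length_cons, pow_succ] at *; omega

lemma length_strOfNat (i : ℕ) : (strOfNat i).length = Nat.log 2 (i + 1) := by
  symm
  rw [Nat.log_eq_iff (by simp), ← num_strOfNat i]
  exact ⟨two_pow_length_le_num _, num_lt_two_pow _⟩

lemma length_strOfNat_le (i : ℕ) : (strOfNat i).length ≤ i := by
  have := two_pow_length_le_num (strOfNat i)
  rw [num_strOfNat] at this
  have := Nat.lt_two_pow_self (n := (strOfNat i).length)
  omega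

lemma exists_strOfNat_eq (p : List Bool) : ∃ i < 2 ^ (p.length + 1), strOfNat i = p :=
  ⟨num p - 1, by have := num_lt_two_pow p; omega, strOfNat_num_sub_one p⟩

lemma num_append_div (a b : List Bool) : num (a ++ b) / 2 ^ a.length = num b := by
  induction a with
  | nil => simp
  | cons x a ih =>
    rw [List.cons_append, num, List.length_cons, pow_succ', ← Nat.div_div_eq_div_mul]
    have : Nat.bit x (num (a ++ b)) / 2 = num (a ++ b) := by
      rw [Nat.bit_val]; cases x <;> simp; omega
    rw [this, ih]

/-- The string of length `l` holding the binary digits of `c`, most significant digit first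
(for `c < 2 ^ l`). -/
def binStr (l c : ℕ) : List Bool := (strOfNat (2 ^ l + c - 1)).reverse

lemma num_reverse_binStr (l c : ℕ) : num (binStr l c).reverse = 2 ^ l + c := by
  have := Nat.one_le_two_pow (n := l)
  rw [binStr, List.reverse_reverse, num_strOfNat]; omega

lemma length_binStr {l c : ℕ} (h : c < 2 ^ l) : (binStr l c).length = l := by
  have := Nat.one_le_two_pow (n := l)
  rw [binStr, List.length_reverse, length_strOfNat, Nat.log_eq_iff (by simp), pow_succ]
  omega

lemma binStr_prefix {l c l' c' : ℕ} (h : c < 2 ^ l) (h' : c' < 2 ^ l')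
    (hp : binStr l c <+: binStr l' c') :
    l ≤ l' ∧ c * 2 ^ (l' - l) ≤ c' ∧ c' < (c + 1) * 2 ^ (l' - l) := by
  have hl : l ≤ l' := by simpa [length_binStr h, length_binStr h'] using hp.length_le
  obtain ⟨r, hr⟩ := hp
  have hlen : r.length = l' - l := by
    have := congrArg List.length hr
    simp only [List.length_append, length_binStr h, length_binStr h'] at this
    omega
  have := num_append_div r.reverse (binStr l c).reverse
  rw [← List.reverse_append, hr, num_reverse_binStr, num_reverse_binStr, List.length_reverse,
    hlen, Nat.div_eq_iff (by positivity)] at this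
  have e : 2 ^ l' = 2 ^ l * 2 ^ (l' - l) := by rw [← pow_add]; congr 1; omega
  have hpos : 0 < 2 ^ (l' - l) := by positivity
  refine ⟨hl, ?_, ?_⟩ <;> rw [e] at this <;> rw [add_mul] at * <;> omega

/-- A prefix-free code for the natural numbers, of length `2 * log₂ (k + 1) + 1`. -/
def natCode (k : ℕ) : List Bool :=
  List.replicate (strOfNat k).length true ++ false :: strOfNat k

lemma length_natCode (k : ℕ) : (natCode k).length = 2 * Nat.log 2 (k + 1) + 1 := by
  simp [natCode, length_strOfNat]; omega

lemma replicate_true_false_prefix {a b : ℕ} {u v : List Bool}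
    (h : List.replicate a true ++ false :: u <+: List.replicate b true ++ false :: v) :
    a = b ∧ u <+: v := by
  induction a generalizing b with
  | zero => cases b with
    | zero => simpa using h
    | succ b => simp [List.replicate_succ] at h
  | succ a ih => cases b with
    | zero => simp [List.replicate_succ] at h
    | succ b =>
      simp only [List.replicate_succ, List.cons_append, List.cons_prefix_cons, true_and] at h
      simpa using ih h

lemma natCode_append_prefix {k k' : ℕ} {u v : List Bool}
    (h : natCode k ++ u <+: natCode k' ++ v) : k = k' ∧ u <+: v := by
  simp only [natCode, List.append_assoc, List.cons_append] at h
  obtain ⟨hl, r, hr⟩ := replicate_true_false_prefix h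
  rw [List.append_assoc] at hr
  obtain ⟨h1, h2⟩ := List.append_inj hr hl
  exact ⟨strOfNat_injective h1, r, h2⟩

lemma uniquelyDecodable_of_prefixFree {α : Type*} {S : Set (List α)} (h0 : [] ∉ S)
    (h : ∀ p ∈ S, ∀ q ∈ S, p <+: q → p = q) : InformationTheory.UniquelyDecodable S := by
  intro L₁
  induction L₁ with
  | nil =>
    intro L₂ _ h2 he
    cases L₂ with
    | nil => rfl
    | cons w L =>
      simp only [List.flatten_nil, List.flatten_cons, List.nil_eq, List.append_eq_nil_iff] at he
      exact absurd (he.1 ▸ h2 w (by simp)) h0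
  | cons u L₁ ih =>
    intro L₂ h1 h2 he
    cases L₂ with
    | nil =>
      simp only [List.flatten_nil, List.flatten_cons, List.append_eq_nil_iff] at he
      exact absurd (he.1 ▸ h1 u (by simp)) h0
    | cons w L =>
      simp only [List.flatten_cons] at he
      have hu := h1 u (by simp)
      have hw := h2 w (by simp)
      have huw : u = w := by
        rcases List.prefix_or_prefix_of_prefix (List.prefix_append u L₁.flatten)
          (he ▸ List.prefix_append w L.flatten) with h' | h'
        · exact h _ hu _ hw h'
        · exact (h _ hw _ hu h').symm
      subst huw
      rw [ih L (fun w hw => h1 w (by simp [hw])) (fun w hw => h2 w (by simp [hw]))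
        (List.append_cancel_left he)]

/-- Kraft's inequality for finite prefix-free sets. -/
lemma kraft_of_prefixFree (S : Finset (List Bool)) (h : ∀ p ∈ S, ∀ q ∈ S, p <+: q → p = q) :
    ∑ p ∈ S, (2 : ℝ) ^ (-(p.length : ℤ)) ≤ 1 := by
  by_cases h0 : [] ∈ S
  · have : S = {[]} := Finset.eq_singleton_iff_unique_mem.2
      ⟨h0, fun p hp => (h _ h0 _ hp List.nil_prefix).symm⟩
    simp [this]
  · have := InformationTheory.kraft_mcmillan_inequality
      (uniquelyDecodable_of_prefixFree (S := (S : Set (List Bool))) (by simpa using h0)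
        (by simpa using h))
    simpa using this

section Computability

variable {α : Type*} [Primcodable α]

lemma Computable.add' {f g : α → ℕ} (hf : Computable f) (hg : Computable g) :
    Computable fun a => f a + g a :=
  Primrec.nat_add.to_comp.comp hf hg

lemma Computable.sub' {f g : α → ℕ} (hf : Computable f) (hg : Computable g) :
    Computable fun a => f a - g a :=
  Primrec.nat_sub.to_comp.comp hf hg

lemma Computable.mul' {f g : α → ℕ} (hf : Computable f) (hg : Computable g) :
    Computable fun a => f a * g a :=
  Primrec.nat_mul.to_comp.comp hf hg

lemma Computable.div' {f g : α → ℕ} (hf : Computable f) (hg : Computable g) :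
    Computable fun a => f a / g a :=
  Primrec.nat_div.to_comp.comp hf hg

lemma Computable.pow' {f g : α → ℕ} (hf : Computable f) (hg : Computable g) :
    Computable fun a => f a ^ g a :=
  (Primrec₂.unpaired'.1 Nat.Primrec.pow).to_comp.comp hf hg

lemma Computable.natPair {f g : α → ℕ} (hf : Computable f) (hg : Computable g) :
    Computable fun a => Nat.pair (f a) (g a) :=
  Primrec₂.natPair.to_comp.comp hf hg

lemma Computable.decideLt {f g : α → ℕ} (hf : Computable f) (hg : Computable g) :
    Computable fun a => decide (f a < g a) :=
  (PrimrecRel.decide Primrec.nat_lt).to_comp.comp hf hg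

lemma Computable.decideEq {β : Type*} [Primcodable β] [DecidableEq β] {f g : α → β}
    (hf : Computable f) (hg : Computable g) : Computable fun a => decide (f a = g a) :=
  (PrimrecRel.decide Primrec.eq).to_comp.comp hf hg

lemma Computable.boolAnd {f g : α → Bool} (hf : Computable f) (hg : Computable g) :
    Computable fun a => f a && g a :=
  Primrec.and.to_comp.comp hf hg

lemma Computable.boolOr {f g : α → Bool} (hf : Computable f) (hg : Computable g) :
    Computable fun a => f a || g a :=
  Primrec.or.to_comp.comp hf hg

lemma Computable.boolToNat {f : α → Bool} (hf : Computable f) :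
    Computable fun a => (f a).toNat :=
  (Primrec.dom_finite Bool.toNat).to_comp.comp hf

lemma Computable.optionIsSome {β : Type*} [Primcodable β] {f : α → Option β}
    (hf : Computable f) : Computable fun a => (f a).isSome :=
  Primrec.option_isSome.to_comp.comp hf

lemma Computable.sum_range {f : α → ℕ → ℕ} {N : α → ℕ} (hf : Computable₂ f)
    (hN : Computable N) : Computable fun a => ∑ i ∈ Finset.range (N a), f a i := by
  refine (Computable.nat_rec (f := N) (g := fun _ => 0) (h := fun a q => q.2 + f a q.1)
    hN (Computable.const 0) ?_).of_eq fun a => ?_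
  · exact Computable.add' (Computable.snd.comp Computable.snd)
      (hf.comp Computable.fst (Computable.fst.comp Computable.snd))
  · induction N a with
    | zero => rfl
    | succ n ih => rw [Finset.sum_range_succ, ← ih]

lemma computable_strOfNat : Computable strOfNat := by
  have : Computable₂ fun (_ : Unit) n => strOfNat n := by
    refine Computable.nat_strong_rec _ (g := fun _ l => Nat.casesOn l.length (some [])
      fun n => (l[n / 2]?).map fun s => decide (n % 2 = 1) :: s) ?_ ?_
    · refine Computable.nat_casesOn (Computable.list_length.comp Computable.snd)
        (Computable.const _) ?_
      refine Computable.option_map ?_ ?_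
      · exact Computable.list_getElem?.comp (Computable.snd.comp Computable.fst)
          (Computable.div' Computable.snd (Computable.const 2))
      · refine Computable.list_cons.comp (Computable.decideEq ?_ (Computable.const 1))
          Computable.snd
        exact Primrec.nat_mod.to_comp.comp (Computable.snd.comp Computable.fst)
          (Computable.const 2)
    · rintro _ (_ | n)
      · simp [strOfNat_zero]
      · have : n / 2 < n + 1 := by omega
        simp [strOfNat_succ, this]
  exact this.comp (Computable.const ()) Computable.id

lemma Computable.binStr {f g : α → ℕ} (hf : Computable f) (hg : Computable g) :
    Computable fun a => binStr (f a) (g a) :=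
  Computable.list_reverse.comp (computable_strOfNat.comp
    (.sub' (.add' (.pow' (.const 2) hf) hg) (.const 1)))

lemma Computable.natCode {f : α → ℕ} (hf : Computable f) :
    Computable fun a => natCode (f a) := by
  have hr : Computable fun n => List.replicate n true := by
    refine (Computable.nat_rec (f := id) (g := fun _ : ℕ => ([] : List Bool))
      (h := fun _ q => true :: q.2) Computable.id (Computable.const _) ?_).of_eq fun n => ?_
    · exact Computable.list_cons.comp (Computable.const true) (Computable.snd.comp Computable.snd)
    · induction n with
      | zero => rfl
      | succ n ih => exact congrArg (List.cons true) ih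
  have hs := computable_strOfNat.comp hf
  exact Computable.list_append.comp (hr.comp (Computable.list_length.comp hs))
    (Computable.list_cons.comp (Computable.const false) hs)

/-- The first value produced by `f` on an argument below `t`. -/
def firstSome {σ : Type*} (f : ℕ → Option σ) : ℕ → Option σ
  | 0 => none
  | t + 1 => (firstSome f t).elim (f t) some

lemma firstSome_mono {σ : Type*} {f : ℕ → Option σ} {t t' : ℕ} (h : t ≤ t') {v : σ}
    (hv : firstSome f t = some v) : firstSome f t' = some v := by
  induction t', h using Nat.le_induction with
  | base => exact hv
  | succ t' _ ih => simp [firstSome, ih]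

lemma exists_of_firstSome {σ : Type*} {f : ℕ → Option σ} {t : ℕ} {v : σ}
    (hv : firstSome f t = some v) : ∃ m < t, f m = some v := by
  induction t with
  | zero => simp [firstSome] at hv
  | succ t ih =>
    rw [firstSome] at hv
    cases h : firstSome f t with
    | none => exact ⟨t, by omega, by simpa [h] using hv⟩
    | some w =>
      obtain ⟨m, hm, e⟩ := ih (by rw [h] at hv ⊢; exact hv)
      exact ⟨m, by omega, e⟩

lemma firstSome_isSome {σ : Type*} {f : ℕ → Option σ} {m : ℕ} (h : (f m).isSome) :
    (firstSome f (m + 1)).isSome := by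
  rw [firstSome]
  cases firstSome f m <;> simp [h]

lemma firstSome_congr {σ : Type*} {f g : ℕ → Option σ} {t : ℕ} (h : ∀ m < t, f m = g m) :
    firstSome f t = firstSome g t := by
  induction t with
  | zero => rfl
  | succ t ih => rw [firstSome, firstSome, ih fun m hm => h m (by omega), h t (by omega)]

lemma Computable.firstSome {σ : Type*} [Primcodable σ] {f : α → ℕ → Option σ} {t : α → ℕ}
    (hf : Computable₂ f) (ht : Computable t) : Computable fun a => firstSome (f a) (t a) := by
  refine (Computable.nat_rec (f := t) (g := fun _ => (none : Option σ))
    (h := fun a q => q.2.elim (f a q.1) some) ht (Computable.const none) ?_).of_eq fun a => ?_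
  · refine (Computable.option_casesOn (o := fun q : α × ℕ × Option σ => q.2.2)
      (f := fun q => f q.1 q.2.1) (g := fun _ v => some v) (Computable.snd.comp Computable.snd)
      (hf.comp Computable.fst (Computable.fst.comp Computable.snd))
      (Computable.option_some.comp Computable.snd)).of_eq fun q => ?_
    rcases q with ⟨a, n, _ | v⟩ <;> rfl
  · induction t a with
    | zero => rfl
    | succ n ih => simp only [_root_.firstSome, ← ih]

end Computability

/-- The machine that runs through `m = 0, 1, ...` and outputs the first value of
`G m p y n`. -/
def Machine.search (G : ℕ → List Bool → ℕ → ℕ → Option ℕ)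
    (hG : Computable fun q : (ℕ × List Bool) × ℕ × ℕ => G q.1.1 q.1.2 q.2.1 q.2.2) :
    Machine where
  step t p y n := firstSome (fun m => G m p y n) t
  computable_step := by
    refine Computable.firstSome (α := (ℕ × List Bool) × ℕ × ℕ)
      (t := fun q => q.1.1)
      (f := fun q m => G m q.1.2 q.2.1 q.2.2) ?_ (Computable.fst.comp Computable.fst)
    have hq := Computable.fst (α := (ℕ × List Bool) × ℕ × ℕ) (β := ℕ)
    have hm : Computable fun q : ((ℕ × List Bool) × ℕ × ℕ) × ℕ => ((q.2, q.1.1.2), q.1.2) :=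
      .pair (.pair .snd (Computable.snd.comp (Computable.fst.comp hq))) (Computable.snd.comp hq)
    have h := hG.comp hm
    exact h
  mono h hv := firstSome_mono h hv

lemma Machine.exists_of_search_outputs {G : ℕ → List Bool → ℕ → ℕ → Option ℕ}
    {hG : Computable fun q : (ℕ × List Bool) × ℕ × ℕ => G q.1.1 q.1.2 q.2.1 q.2.2}
    {p : List Bool} {y n v : ℕ} (h : (Machine.search G hG).Outputs p y n v) :
    ∃ m, G m p y n = some v := by
  obtain ⟨t, ht⟩ := h
  obtain ⟨m, -, hm⟩ := exists_of_firstSome ht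
  exact ⟨m, hm⟩

lemma Machine.search_haltsOn {G : ℕ → List Bool → ℕ → ℕ → Option ℕ}
    {hG : Computable fun q : (ℕ × List Bool) × ℕ × ℕ => G q.1.1 q.1.2 q.2.1 q.2.2}
    {p : List Bool} {y n m : ℕ} (h : (G m p y n).isSome) :
    (Machine.search G hG).HaltsOn p y n := by
  obtain ⟨v, hv⟩ := Option.isSome_iff_exists.1 (firstSome_isSome (f := fun m => G m p y n) h)
  exact ⟨v, m + 1, hv⟩

/-- The oracle machine that runs through `m = 0, 1, ...` and outputs the first value of
`G m p n w`, where `w` is the initial segment of length `m` of the oracle. -/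
def OracleMachine.search (G : ℕ → List Bool → ℕ → List Bool → Option ℕ)
    (hG : Computable fun q : ((ℕ × List Bool) × ℕ) × List Bool => G q.1.1.1 q.1.1.2 q.1.2 q.2) :
    OracleMachine where
  step t p _ n w := firstSome (fun m => G m p n (w.take m)) t
  computable_step := by
    refine Computable.firstSome (α := ((ℕ × List Bool) × ℕ × ℕ) × List Bool)
      (t := fun q => q.1.1.1)
      (f := fun q m => G m q.1.1.2 q.1.2.2 (q.2.take m)) ?_
      (Computable.fst.comp (Computable.fst.comp Computable.fst))
    have hq := Computable.fst (α := ((ℕ × List Bool) × ℕ × ℕ) × List Bool) (β := ℕ)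
    have hr := Computable.fst.comp hq
    have hm : Computable fun q : (((ℕ × List Bool) × ℕ × ℕ) × List Bool) × ℕ =>
        (((q.2, q.1.1.1.2), q.1.1.2.2), q.1.2.take q.2) :=
      .pair (.pair (.pair .snd (Computable.snd.comp (Computable.fst.comp hr)))
        (Computable.snd.comp (Computable.snd.comp hr)))
        (Primrec.list_take.to_comp.comp .snd (Computable.snd.comp hq))
    have h := hG.comp hm
    exact h
  mono := by
    intro t t' p _ n v O h hv
    refine firstSome_mono h ?_
    rw [← hv]
    refine firstSome_congr fun m hm => ?_
    congr 1
    apply List.ext_getElem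
    · simp; omega
    · intro i h1 h2; simp

/-- The first `m` bits of an oracle. -/
def oraclePrefix (O : ℕ → Bool) (m : ℕ) : List Bool := List.ofFn fun i : Fin m => O i

lemma getD_oraclePrefix (O : ℕ → Bool) {m i : ℕ} (h : i < m) :
    (oraclePrefix O m).getD i false = O i := by
  simp [oraclePrefix, List.getD_eq_getElem?_getD, h]

lemma take_oraclePrefix (O : ℕ → Bool) {m t : ℕ} (h : m ≤ t) :
    (List.ofFn fun i : Fin t => O i).take m = oraclePrefix O m := by
  apply List.ext_getElem
  · simp [oraclePrefix]; omega
  · intro i h1 h2; simp [oraclePrefix]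

lemma OracleMachine.exists_of_search_outputs {O : ℕ → Bool}
    {G : ℕ → List Bool → ℕ → List Bool → Option ℕ}
    {hG : Computable fun q : ((ℕ × List Bool) × ℕ) × List Bool => G q.1.1.1 q.1.1.2 q.1.2 q.2}
    {p : List Bool} {y n v : ℕ} (h : (OracleMachine.search G hG).Outputs O p y n v) :
    ∃ m, G m p n (oraclePrefix O m) = some v := by
  obtain ⟨t, ht⟩ := h
  obtain ⟨m, hm, e⟩ := exists_of_firstSome ht
  exact ⟨m, by rwa [take_oraclePrefix O hm.le] at e⟩

lemma OracleMachine.search_haltsOn {O : ℕ → Bool}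
    {G : ℕ → List Bool → ℕ → List Bool → Option ℕ}
    {hG : Computable fun q : ((ℕ × List Bool) × ℕ) × List Bool => G q.1.1.1 q.1.1.2 q.1.2 q.2}
    {p : List Bool} {y n m : ℕ} (h : (G m p n (oraclePrefix O m)).isSome) :
    (OracleMachine.search G hG).HaltsOn O p y n := by
  rw [← take_oraclePrefix O (Nat.le_succ m)] at h
  obtain ⟨v, hv⟩ := Option.isSome_iff_exists.1 (firstSome_isSome
    (f := fun m' => G m' p n ((List.ofFn fun i : Fin (m + 1) => O i).take m')) h)
  exact ⟨v, m + 1, hv⟩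

namespace Machine

variable (Φ : Machine)

/-- The output, if any, of the `i`-th program after `s` steps. -/
def outAt (s n i : ℕ) : Option ℕ := Φ.step s (strOfNat i) 0 n

/-- Whether the `i`-th program has produced an output in `2^n` after `s` steps. -/
def halted (s n i : ℕ) : Bool := (Φ.outAt s n i).elim false fun v => decide (v < 2 ^ n)

/-- `2 ^ L` times the measure of the first `L` programs that have halted after `s` steps. -/
def omegaNum (s L n : ℕ) : ℕ :=
  ∑ i ∈ Finset.range L, (Φ.halted s n i).toNat * 2 ^ (L - (strOfNat i).length)

section Computability

variable {α : Type*} [Primcodable α] {f g h : α → ℕ}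

lemma computable_outAt (hf : Computable f) (hg : Computable g) (hh : Computable h) :
    Computable fun a => Φ.outAt (f a) (g a) (h a) := by
  have hm : Computable fun a => ((f a, strOfNat (h a)), ((0 : ℕ), g a)) :=
    .pair (.pair hf (computable_strOfNat.comp hh)) (.pair (.const 0) hg)
  have h := Φ.computable_step.comp hm
  exact h

lemma computable_halted (hf : Computable f) (hg : Computable g) (hh : Computable h) :
    Computable fun a => Φ.halted (f a) (g a) (h a) := by
  refine (Computable.option_casesOn (Φ.computable_outAt hf hg hh) (Computable.const false)
    (g := fun a v => decide (v < 2 ^ g a)) ?_).of_eq fun a => ?_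
  · exact Computable.decideLt Computable.snd
      (Computable.pow' (Computable.const 2) (hg.comp Computable.fst))
  · unfold halted; cases Φ.outAt (f a) (g a) (h a) <;> rfl

lemma computable_omegaNum (hf : Computable f) (hg : Computable g) (hh : Computable h) :
    Computable fun a => Φ.omegaNum (f a) (g a) (h a) := by
  refine Computable.sum_range (f := fun a i => (Φ.halted (f a) (h a) i).toNat *
    2 ^ (g a - (strOfNat i).length)) ?_ hg
  have h1 := Computable.fst (α := α) (β := ℕ)
  have h2 := Computable.snd (α := α) (β := ℕ)
  exact Computable.mul' (Computable.boolToNat (Φ.computable_halted (hf.comp h1) (hh.comp h1) h2))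
    (Computable.pow' (Computable.const 2) (Computable.sub' (hg.comp h1)
      (Computable.list_length.comp (computable_strOfNat.comp h2))))

end Computability

/-- Whether the measure of the first `s` programs that have halted after `s` steps
exceeds `(m - 1) / 2 ^ j`. -/
def omegaReached (s j m n : ℕ) : Bool :=
  decide (m * 2 ^ s < Φ.omegaNum s s n * 2 ^ j + 2 ^ s)

/-- The search function of a machine that, given (a code of) `j` and `m`, finds a time `s`
with `omegaReached s j m n`. -/
def timeSearch (r : ℕ) (p : List Bool) (_y n : ℕ) : Option ℕ :=
  bif decide (p = natCode r.unpair.2) &&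
      Φ.omegaReached r.unpair.1 r.unpair.2.unpair.1 r.unpair.2.unpair.2 n
  then some r.unpair.1 else none

lemma computable_timeSearch :
    Computable fun q : (ℕ × List Bool) × ℕ × ℕ => Φ.timeSearch q.1.1 q.1.2 q.2.1 q.2.2 := by
  have hr : Computable fun q : (ℕ × List Bool) × ℕ × ℕ => q.1.1 :=
    Computable.fst.comp Computable.fst
  have hp : Computable fun q : (ℕ × List Bool) × ℕ × ℕ => q.1.2 :=
    Computable.snd.comp Computable.fst
  have hn : Computable fun q : (ℕ × List Bool) × ℕ × ℕ => q.2.2 :=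
    Computable.snd.comp Computable.snd
  have hu := Primrec.unpair.to_comp.comp hr
  have hs := Computable.fst.comp hu
  have ha := Computable.snd.comp hu
  have hjm := Primrec.unpair.to_comp.comp ha
  have h2s := Computable.pow' (Computable.const 2) hs
  refine Computable.cond (Computable.boolAnd (Computable.decideEq hp (Computable.natCode ha)) ?_)
    (Computable.option_some.comp hs) (Computable.const none)
  exact Computable.decideLt (Computable.mul' (Computable.snd.comp hjm) h2s)
    (Computable.add' (Computable.mul' (Φ.computable_omegaNum hs hs hn)
      (Computable.pow' (Computable.const 2) (Computable.fst.comp hjm))) h2s)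

variable {Φ}

lemma timeSearch_eq_some {r : ℕ} {p : List Bool} {y n v : ℕ}
    (h : Φ.timeSearch r p y n = some v) :
    p = natCode r.unpair.2 ∧ v = r.unpair.1 ∧
      Φ.omegaReached r.unpair.1 r.unpair.2.unpair.1 r.unpair.2.unpair.2 n = true := by
  unfold timeSearch at h
  rw [Bool.cond_eq_ite] at h
  split at h
  · rename_i hc
    simp only [Bool.and_eq_true, decide_eq_true_eq] at hc
    exact ⟨hc.1, by simpa using h.symm, hc.2⟩
  · simp at h

lemma Outputs.unique {p : List Bool} {y n v v' : ℕ} (h : Φ.Outputs p y n v)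
    (h' : Φ.Outputs p y n v') : v = v' := by
  obtain ⟨t, ht⟩ := h
  obtain ⟨t', ht'⟩ := h'
  have h1 := Φ.mono (le_max_left t t') ht
  rw [Φ.mono (le_max_right t t') ht'] at h1
  exact (Option.some.inj h1).symm

lemma Total.exists_shortestProg (h : Φ.Total) (x y n : ℕ) : ∃ p, Φ.ShortestProg p x y n := by
  obtain ⟨p, hp⟩ := h x y n
  obtain ⟨q, hq, hq'⟩ := Nat.sInf_mem (s := {l | ∃ p : List Bool, p.length = l ∧
    Φ.Outputs p y n x}) ⟨_, p, rfl, hp⟩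
  exact ⟨q, hq', hq⟩

/-- A time by which the halted programs have large measure is the output of a program
whose index is bounded computably. -/
lemma POptimal.exists_time (hΦ : Φ.POptimal) : ∃ c : ℕ, ∀ n j m s₀ : ℕ,
    Φ.omegaReached s₀ j m n = true → ∃ s, ∃ i < 2 ^ (2 * Nat.pair j m + c + 2),
      Φ.Outputs (strOfNat i) 0 n s ∧ Φ.omegaReached s j m n = true := by
  obtain ⟨-, htot, hopt⟩ := hΦ
  obtain ⟨c, hc⟩ := hopt (Machine.search Φ.timeSearch Φ.computable_timeSearch) (by
    rintro p q y n ⟨v, hv⟩ ⟨v', hv'⟩ hpq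
    obtain ⟨r, hr⟩ := exists_of_search_outputs hv
    obtain ⟨r', hr'⟩ := exists_of_search_outputs hv'
    have h := (timeSearch_eq_some hr).1
    have h' := (timeSearch_eq_some hr').1
    have : natCode r.unpair.2 ++ [] <+: natCode r'.unpair.2 ++ [] := by simpa [← h, ← h']
    rw [h, h', (natCode_append_prefix this).1])
  refine ⟨c, fun n j m s₀ h₀ => ?_⟩
  have hs : (Φ.timeSearch (Nat.pair s₀ (Nat.pair j m)) (natCode (Nat.pair j m)) 0 n).isSome := by
    simp [timeSearch, h₀]
  obtain ⟨s, hs⟩ := search_haltsOn (hG := Φ.computable_timeSearch) hs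
  obtain ⟨r, hr⟩ := exists_of_search_outputs hs
  obtain ⟨h1, rfl, h3⟩ := timeSearch_eq_some hr
  have ha : natCode (Nat.pair j m) ++ [] <+: natCode r.unpair.2 ++ [] := by simp [← h1]
  rw [← (natCode_append_prefix ha).1, Nat.unpair_pair] at h3
  obtain ⟨q, hq, hql⟩ := htot.exists_shortestProg r.unpair.1 0 n
  obtain ⟨i, hi, rfl⟩ := exists_strOfNat_eq q
  refine ⟨_, i, hi.trans_le (Nat.pow_le_pow_right (by simp) ?_), hq, h3⟩
  have := hc _ _ _ _ hs
  rw [length_natCode] at this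
  have := Nat.log_lt_self 2 (Nat.succ_ne_zero (Nat.pair j m))
  simp only [Nat.succ_eq_add_one] at this
  omega

end Machine

namespace Machine

variable (Φ : Machine)

/-- The number of programs whose halting must be known to bound the time needed at
precision `e`. -/
def idxBound (c e : ℕ) : ℕ := 2 ^ (2 * Nat.pair (e + 3) (2 ^ (e + 3)) + c + 2)

/-- The sum of the outputs, within `s` steps, of the first `idxBound c e` programs. -/
def bigTime (c s n e : ℕ) : ℕ :=
  ∑ j ∈ Finset.range (idxBound c e), (Φ.outAt s n j).getD 0

/-- Whether, relative to `B`, the measure of the programs halted at time `t` is still more than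
`2 ^ (-(e + 1))` below its final value. -/
def isEarly (B n e t : ℕ) : Bool :=
  decide (Φ.omegaNum t B n * 2 ^ (e + 1) + 2 ^ B < Φ.omegaNum B B n * 2 ^ (e + 1))

/-- The first time which is not early. -/
def cutTime (c s n e : ℕ) : ℕ :=
  ∑ t ∈ Finset.range (Φ.bigTime c s n e), (Φ.isEarly (Φ.bigTime c s n e) n e t).toNat

/-- Whether the `i`-th program halts with output in `2^n`, but not before the cut time. -/
def late (c s n e i : ℕ) : Bool :=
  Φ.halted s n i && (decide (e = 0) || !(Φ.outAt (Φ.cutTime c s n e) n i).isSome)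

/-- `2 ^ i` times the measure of the late programs of index less than `i`. -/
def lateNum (c s n e i : ℕ) : ℕ :=
  ∑ j ∈ Finset.range i, (Φ.late c s n e j).toNat * 2 ^ (i - (strOfNat j).length)

/-- The numerator of the dyadic interval assigned to the `i`-th program. -/
def codeNum (c s n e i : ℕ) : ℕ :=
  Φ.lateNum c s n e i * 2 ^ ((strOfNat i).length + 2) / 2 ^ i + 1

/-- The Shannon–Fano code of the `i`-th program among the late programs, preceded by a
code of `e`. -/
def codeword (c s n e i : ℕ) : List Bool :=
  natCode e ++ binStr ((strOfNat i).length + 2 - e) (Φ.codeNum c s n e i)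

/-- The number of programs whose halting must be known in order to compute `codeword`. -/
def codeBound (c e i : ℕ) : ℕ := idxBound c e + i + 1

/-- Whether the first `J` programs which halt according to the oracle prefix `w` (of length `m`)
are those that have halted after `s` steps. -/
def oracleAgrees (m s n J : ℕ) (w : List Bool) : Bool :=
  decide (Nat.pair J n < m + 1) &&
    decide (∑ j ∈ Finset.range J,
      (!decide (w.getD (Nat.pair j n) false = (Φ.outAt s n j).isSome)).toNat = 0)

/-- The search function of the oracle machine decoding `codeword`. -/
def codeSearch (c m : ℕ) (p : List Bool) (n : ℕ) (w : List Bool) : Option ℕ :=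
  bif (Φ.oracleAgrees m m.unpair.1 n (codeBound c m.unpair.2.unpair.1 m.unpair.2.unpair.2) w &&
      Φ.late c m.unpair.1 n m.unpair.2.unpair.1 m.unpair.2.unpair.2) &&
      decide (p = Φ.codeword c m.unpair.1 n m.unpair.2.unpair.1 m.unpair.2.unpair.2)
  then Φ.outAt m.unpair.1 n m.unpair.2.unpair.2 else none

section Computability

variable {α : Type*} [Primcodable α] {s n e i : α → ℕ} (c : ℕ)

lemma computable_idxBound (he : Computable e) : Computable fun a => idxBound c (e a) := by
  have h := Computable.add' he (Computable.const 3)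
  exact Computable.pow' (.const 2) (.add' (.add' (.mul' (.const 2)
    (.natPair h (.pow' (.const 2) h))) (.const c)) (.const 2))

lemma computable_bigTime (hs : Computable s) (hn : Computable n) (he : Computable e) :
    Computable fun a => Φ.bigTime c (s a) (n a) (e a) := by
  refine Computable.sum_range (f := fun a j => (Φ.outAt (s a) (n a) j).getD 0) ?_
    (computable_idxBound c he)
  have h1 := Computable.fst (α := α) (β := ℕ)
  exact Computable.option_getD (Φ.computable_outAt (hs.comp h1) (hn.comp h1) Computable.snd)
    (Computable.const 0)

lemma computable_isEarly {B t : α → ℕ} (hB : Computable B) (hn : Computable n)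
    (he : Computable e) (ht : Computable t) :
    Computable fun a => Φ.isEarly (B a) (n a) (e a) (t a) := by
  have h2 := Computable.pow' (Computable.const 2) (Computable.add' he (Computable.const 1))
  exact Computable.decideLt (.add' (.mul' (Φ.computable_omegaNum ht hB hn) h2)
    (.pow' (.const 2) hB)) (.mul' (Φ.computable_omegaNum hB hB hn) h2)

lemma computable_cutTime (hs : Computable s) (hn : Computable n) (he : Computable e) :
    Computable fun a => Φ.cutTime c (s a) (n a) (e a) := by
  have hB := Φ.computable_bigTime c hs hn he
  refine Computable.sum_range
    (f := fun a t => (Φ.isEarly (Φ.bigTime c (s a) (n a) (e a)) (n a) (e a) t).toNat) ?_ hB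
  have h1 := Computable.fst (α := α) (β := ℕ)
  exact Computable.boolToNat (Φ.computable_isEarly (hB.comp h1) (hn.comp h1) (he.comp h1)
    Computable.snd)

lemma computable_late (hs : Computable s) (hn : Computable n) (he : Computable e)
    (hi : Computable i) : Computable fun a => Φ.late c (s a) (n a) (e a) (i a) :=
  Computable.boolAnd (Φ.computable_halted hs hn hi)
    (Computable.boolOr (Computable.decideEq he (Computable.const 0))
      (Primrec.not.to_comp.comp (Computable.optionIsSome
        (Φ.computable_outAt (Φ.computable_cutTime c hs hn he) hn hi))))

lemma computable_lateNum (hs : Computable s) (hn : Computable n) (he : Computable e)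
    (hi : Computable i) : Computable fun a => Φ.lateNum c (s a) (n a) (e a) (i a) := by
  refine Computable.sum_range (f := fun a j =>
    (Φ.late c (s a) (n a) (e a) j).toNat * 2 ^ (i a - (strOfNat j).length)) ?_ hi
  have h1 := Computable.fst (α := α) (β := ℕ)
  have h2 := Computable.snd (α := α) (β := ℕ)
  exact Computable.mul' (Computable.boolToNat
    (Φ.computable_late c (hs.comp h1) (hn.comp h1) (he.comp h1) h2))
    (Computable.pow' (Computable.const 2) (Computable.sub' (hi.comp h1)
      (Computable.list_length.comp (computable_strOfNat.comp h2))))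

lemma computable_codeword (hs : Computable s) (hn : Computable n) (he : Computable e)
    (hi : Computable i) : Computable fun a => Φ.codeword c (s a) (n a) (e a) (i a) := by
  have hl := Computable.add' (Computable.list_length.comp (computable_strOfNat.comp hi))
    (Computable.const 2)
  have h2 : Computable fun _ : α => 2 := Computable.const 2
  exact Computable.list_append.comp (Computable.natCode he) (Computable.binStr
    (Computable.sub' hl he) (Computable.add' (Computable.div' (Computable.mul'
      (Φ.computable_lateNum c hs hn he hi) (Computable.pow' h2 hl)) (Computable.pow' h2 hi))
      (Computable.const 1)))

lemma computable_oracleAgrees {m J : α → ℕ} {w : α → List Bool} (hm : Computable m)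
    (hs : Computable s) (hn : Computable n) (hJ : Computable J) (hw : Computable w) :
    Computable fun a => Φ.oracleAgrees (m a) (s a) (n a) (J a) (w a) := by
  refine Computable.boolAnd (Computable.decideLt (Computable.natPair hJ hn)
    (Computable.add' hm (Computable.const 1))) (Computable.decideEq ?_ (Computable.const 0))
  refine Computable.sum_range (f := fun a j => (!decide ((w a).getD (Nat.pair j (n a)) false =
    (Φ.outAt (s a) (n a) j).isSome)).toNat) ?_ hJ
  have h1 := Computable.fst (α := α) (β := ℕ)
  have h2 := Computable.snd (α := α) (β := ℕ)
  exact Computable.boolToNat (Primrec.not.to_comp.comp (Computable.decideEq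
    ((Primrec.list_getD false).to_comp.comp (hw.comp h1) (Computable.natPair h2 (hn.comp h1)))
    (Computable.optionIsSome (Φ.computable_outAt (hs.comp h1) (hn.comp h1) h2))))

lemma computable_codeSearch :
    Computable fun q : ((ℕ × List Bool) × ℕ) × List Bool =>
      Φ.codeSearch c q.1.1.1 q.1.1.2 q.1.2 q.2 := by
  have hq := Computable.fst (α := (ℕ × List Bool) × ℕ) (β := List Bool)
  have hw := Computable.snd (α := (ℕ × List Bool) × ℕ) (β := List Bool)
  have hm := Computable.fst.comp (Computable.fst.comp hq)
  have hp := Computable.snd.comp (Computable.fst.comp hq)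
  have hn := Computable.snd.comp hq
  have hu := Primrec.unpair.to_comp.comp hm
  have hs := Computable.fst.comp hu
  have hu' := Primrec.unpair.to_comp.comp (Computable.snd.comp hu)
  have he := Computable.fst.comp hu'
  have hi := Computable.snd.comp hu'
  have hJ := Computable.add' (Computable.add' (computable_idxBound c he) hi) (Computable.const 1)
  exact Computable.cond (Computable.boolAnd (Computable.boolAnd
    (Φ.computable_oracleAgrees hm hs hn hJ hw) (Φ.computable_late c hs hn he hi))
    (Computable.decideEq hp (Φ.computable_codeword c hs hn he hi)))
    (Φ.computable_outAt hs hn hi) (Computable.const none)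

end Computability

end Machine

/-- The Kraft weight of the `i`-th string. -/
noncomputable def kraftWeight (i : ℕ) : ℝ := (2 : ℝ) ^ (-((strOfNat i).length : ℤ))

lemma kraftWeight_pos (i : ℕ) : 0 < kraftWeight i := by
  unfold kraftWeight; positivity

lemma two_pow_mul_kraftWeight {L i : ℕ} (h : (strOfNat i).length ≤ L) :
    (2 : ℝ) ^ L * kraftWeight i = 2 ^ (L - (strOfNat i).length) := by
  unfold kraftWeight
  rw [← zpow_natCast, ← zpow_add₀ two_ne_zero, ← zpow_natCast]
  congr 1
  omega

namespace Machine

variable {Φ : Machine}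

lemma outAt_mono {s s' n i v : ℕ} (h : s ≤ s') (hv : Φ.outAt s n i = some v) :
    Φ.outAt s' n i = some v := Φ.mono h hv

lemma outAt_isSome_mono {s s' n i : ℕ} (h : s ≤ s') (hv : (Φ.outAt s n i).isSome) :
    (Φ.outAt s' n i).isSome := by
  obtain ⟨v, hv⟩ := Option.isSome_iff_exists.1 hv
  simp [outAt_mono h hv]

lemma halted_iff {s n i : ℕ} :
    Φ.halted s n i = true ↔ ∃ v < 2 ^ n, Φ.outAt s n i = some v := by
  unfold halted; cases Φ.outAt s n i <;> simp

lemma halted_mono {s s' n i : ℕ} (h : s ≤ s') (hs : Φ.halted s n i = true) :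
    Φ.halted s' n i = true := by
  obtain ⟨v, hv, hs⟩ := halted_iff.1 hs
  exact halted_iff.2 ⟨v, hv, outAt_mono h hs⟩

/-- The weight of the `i`-th program if it has halted in `2^n` after `s` steps. -/
noncomputable def haltWeight (Φ : Machine) (s n i : ℕ) : ℝ :=
  if Φ.halted s n i = true then kraftWeight i else 0

/-- The weight of the `i`-th program if it ever halts in `2^n`. -/
noncomputable def limWeight (Φ : Machine) (n i : ℕ) : ℝ :=
  if ∃ s, Φ.halted s n i = true then kraftWeight i else 0

lemma haltWeight_nonneg (s n i : ℕ) : 0 ≤ Φ.haltWeight s n i := by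
  unfold haltWeight; split_ifs <;> simp [(kraftWeight_pos i).le]

lemma limWeight_nonneg (n i : ℕ) : 0 ≤ Φ.limWeight n i := by
  unfold limWeight; split_ifs <;> simp [(kraftWeight_pos i).le]

lemma haltWeight_mono {s s' : ℕ} (h : s ≤ s') (n i : ℕ) :
    Φ.haltWeight s n i ≤ Φ.haltWeight s' n i := by
  unfold haltWeight
  split_ifs with h1 h2
  exacts [le_rfl, absurd (halted_mono h h1) h2, (kraftWeight_pos i).le, le_rfl]

lemma haltWeight_le_limWeight (s n i : ℕ) : Φ.haltWeight s n i ≤ Φ.limWeight n i := by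
  unfold haltWeight limWeight
  split_ifs with h1 h2
  exacts [le_rfl, absurd ⟨s, h1⟩ h2, (kraftWeight_pos i).le, le_rfl]

lemma OmegaT_eq_tsum (n t : ℕ) : Φ.OmegaT n t = ∑' i, Φ.haltWeight t n i := by
  unfold OmegaT
  rw [← strEquiv.tsum_eq]
  refine tsum_congr fun i => ?_
  simp only [haltWeight, halted_iff, kraftWeight]
  rfl

lemma Omega_eq_tsum (n : ℕ) : Φ.Omega n = ∑' i, Φ.limWeight n i := by
  unfold Omega
  rw [← strEquiv.tsum_eq]
  refine tsum_congr fun i => ?_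
  simp only [limWeight, halted_iff, kraftWeight]
  refine if_congr ⟨?_, ?_⟩ rfl rfl
  · rintro ⟨v, hv, s, hs⟩
    exact ⟨s, v, hv, hs⟩
  · rintro ⟨s, v, hv, hs⟩
    exact ⟨v, hv, s, hs⟩

lemma sum_kraftWeight_le_one (hpf : Φ.PrefixFree) {n : ℕ} (S : Finset ℕ)
    (hS : ∀ i ∈ S, Φ.HaltsOn (strOfNat i) 0 n) : ∑ i ∈ S, kraftWeight i ≤ 1 := by
  have := kraft_of_prefixFree (S.image strOfNat) (by
    simp only [Finset.mem_image, forall_exists_index, and_imp]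
    rintro _ i hi rfl _ j hj rfl hp
    exact hpf (hS i hi) (hS j hj) hp)
  rwa [Finset.sum_image fun i _ j _ h => strOfNat_injective h] at this

lemma sum_limWeight_le_one (hpf : Φ.PrefixFree) (n : ℕ) (S : Finset ℕ) :
    ∑ i ∈ S, Φ.limWeight n i ≤ 1 := by
  unfold limWeight
  rw [← Finset.sum_filter]
  refine sum_kraftWeight_le_one hpf (n := n) _ fun i hi => ?_
  obtain ⟨s, hs⟩ := (Finset.mem_filter.1 hi).2
  obtain ⟨v, -, hv⟩ := halted_iff.1 hs
  exact ⟨v, s, hv⟩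

lemma summable_limWeight (hpf : Φ.PrefixFree) (n : ℕ) : Summable (Φ.limWeight n) :=
  summable_of_sum_le (limWeight_nonneg n) (sum_limWeight_le_one hpf n)

lemma summable_haltWeight (hpf : Φ.PrefixFree) (s n : ℕ) : Summable (Φ.haltWeight s n) :=
  (summable_limWeight hpf n).of_nonneg_of_le (haltWeight_nonneg s n) (haltWeight_le_limWeight s n)

lemma Omega_le_one (hpf : Φ.PrefixFree) (n : ℕ) : Φ.Omega n ≤ 1 := by
  rw [Omega_eq_tsum]
  exact (summable_limWeight hpf n).tsum_le_of_sum_le (sum_limWeight_le_one hpf n)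

lemma Omega_nonneg (n : ℕ) : 0 ≤ Φ.Omega n := by
  rw [Omega_eq_tsum]
  exact tsum_nonneg (limWeight_nonneg n)

lemma sum_haltWeight_le_OmegaT (hpf : Φ.PrefixFree) (s n : ℕ) (S : Finset ℕ) :
    ∑ i ∈ S, Φ.haltWeight s n i ≤ Φ.OmegaT n s := by
  rw [OmegaT_eq_tsum]
  exact (summable_haltWeight hpf s n).sum_le_tsum S fun i _ => haltWeight_nonneg s n i

lemma sum_limWeight_sub_le (hpf : Φ.PrefixFree) (s n : ℕ) (S : Finset ℕ) :
    ∑ i ∈ S, (Φ.limWeight n i - Φ.haltWeight s n i) ≤ Φ.Omega n - Φ.OmegaT n s := by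
  rw [OmegaT_eq_tsum, Omega_eq_tsum,
    ← (summable_limWeight hpf n).tsum_sub (summable_haltWeight hpf s n)]
  exact ((summable_limWeight hpf n).sub (summable_haltWeight hpf s n)).sum_le_tsum S
    fun i _ => sub_nonneg.2 (haltWeight_le_limWeight s n i)

/-- The measure of the first `L` programs that have halted after `s` steps. -/
noncomputable def partialOmega (Φ : Machine) (s L n : ℕ) : ℝ := ∑ i ∈ Finset.range L, Φ.haltWeight s n i

lemma cast_omegaNum (s L n : ℕ) : (Φ.omegaNum s L n : ℝ) = 2 ^ L * Φ.partialOmega s L n := by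
  unfold omegaNum partialOmega haltWeight
  push_cast
  rw [Finset.mul_sum]
  refine Finset.sum_congr rfl fun i hi => ?_
  have : (strOfNat i).length ≤ L := (length_strOfNat_le i).trans (Finset.mem_range.1 hi).le
  split_ifs with h
  · rw [two_pow_mul_kraftWeight this, h]; simp
  · simp [h]

lemma partialOmega_mono {s s' L L' : ℕ} (hs : s ≤ s') (hL : L ≤ L') (n : ℕ) :
    Φ.partialOmega s L n ≤ Φ.partialOmega s' L' n :=
  (Finset.sum_le_sum fun i _ => haltWeight_mono hs n i).trans
    (Finset.sum_le_sum_of_subset_of_nonneg (Finset.range_mono hL)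
      fun i _ _ => haltWeight_nonneg s' n i)

lemma exists_partialOmega_gt (hpf : Φ.PrefixFree) (n : ℕ) {ε : ℝ} (hε : 0 < ε) :
    ∃ s, Φ.Omega n - ε < Φ.partialOmega s s n := by
  have h := (summable_limWeight hpf n).hasSum.tendsto_sum_nat
  rw [← Omega_eq_tsum] at h
  obtain ⟨L, hL⟩ := ((h.eventually (lt_mem_nhds (sub_lt_self _ hε)))).exists
  have hex : ∀ i, ∃ s, Φ.haltWeight s n i = Φ.limWeight n i := fun i => by
    unfold haltWeight limWeight
    split_ifs with h
    · obtain ⟨s, hs⟩ := h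
      exact ⟨s, by simp [hs]⟩
    · push Not at h
      exact ⟨0, by simp [h]⟩
  choose f hf using hex
  refine ⟨max L ((Finset.range L).sup f), hL.trans_le ?_⟩
  refine le_trans ?_ (partialOmega_mono (le_max_right L _) (le_max_left _ _) n)
  exact Finset.sum_le_sum fun i hi => (hf i).symm.le.trans
    (haltWeight_mono (Finset.le_sup (f := f) hi) n i)

lemma Omega_sub_OmegaT_tk_le (hpf : Φ.PrefixFree) (n k : ℕ) :
    Φ.Omega n - Φ.OmegaT n (Φ.tk n k) ≤ (2 : ℝ) ^ (-(k : ℤ)) := by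
  refine Nat.sInf_mem (s := {t | Φ.Omega n - Φ.OmegaT n t ≤ (2 : ℝ) ^ (-(k : ℤ))}) ?_
  obtain ⟨s, hs⟩ := exists_partialOmega_gt hpf n (ε := (2 : ℝ) ^ (-(k : ℤ))) (by positivity)
  have : Φ.partialOmega s s n ≤ Φ.OmegaT n s := sum_haltWeight_le_OmegaT hpf s n _
  exact ⟨s, by simp only [Set.mem_ofPred_eq]; linarith⟩

/-- All programs among the first `J` that ever halt have halted after `s` steps. -/
def Settled (Φ : Machine) (s n J : ℕ) : Prop :=
  ∀ j < J, Φ.HaltsOn (strOfNat j) 0 n → (Φ.outAt s n j).isSome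

lemma Settled.mono {s s' n J J' : ℕ} (h : Φ.Settled s n J) (hs : s ≤ s') (hJ : J' ≤ J) :
    Φ.Settled s' n J' :=
  fun j hj hH => outAt_isSome_mono hs (h j (hj.trans_le hJ) hH)

lemma exists_settled (n J : ℕ) : ∃ s, Φ.Settled s n J := by
  have hex : ∀ j, ∃ s, Φ.HaltsOn (strOfNat j) 0 n → (Φ.outAt s n j).isSome := fun j => by
    by_cases h : Φ.HaltsOn (strOfNat j) 0 n
    · obtain ⟨v, s, hs⟩ := h
      exact ⟨s, fun _ => by simp [outAt, hs]⟩
    · exact ⟨0, fun h' => absurd h' h⟩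
  choose f hf using hex
  exact ⟨(Finset.range J).sup f, fun j hj hH =>
    outAt_isSome_mono (Finset.le_sup (f := f) (Finset.mem_range.2 hj)) (hf j hH)⟩

lemma Settled.outAt_eq {s s' n J j : ℕ} (h : Φ.Settled s n J) (hs : s ≤ s') (hj : j < J) :
    Φ.outAt s n j = Φ.outAt s' n j := by
  cases h' : Φ.outAt s' n j with
  | none =>
    cases h'' : Φ.outAt s n j with
    | none => rfl
    | some v => rw [outAt_mono hs h''] at h'; cases h'
  | some v =>
    obtain ⟨u, hu⟩ := Option.isSome_iff_exists.1 (h j hj ⟨v, s', h'⟩)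
    rw [← h', outAt_mono hs hu, hu]

variable {c s s' n e i : ℕ}

lemma Settled.bigTime_eq (h : Φ.Settled s n (idxBound c e)) (hs : s ≤ s') :
    Φ.bigTime c s n e = Φ.bigTime c s' n e :=
  Finset.sum_congr rfl fun j hj => by rw [h.outAt_eq hs (Finset.mem_range.1 hj)]

lemma Settled.cutTime_eq (h : Φ.Settled s n (idxBound c e)) (hs : s ≤ s') :
    Φ.cutTime c s n e = Φ.cutTime c s' n e := by
  unfold cutTime; rw [h.bigTime_eq hs]

lemma Settled.late_eq (h : Φ.Settled s n (codeBound c e i)) (hs : s ≤ s') {j : ℕ} (hj : j ≤ i) :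
    Φ.late c s n e j = Φ.late c s' n e j := by
  unfold late halted
  rw [Settled.cutTime_eq (h.mono le_rfl (by unfold codeBound; omega)) hs,
    h.outAt_eq hs (by unfold codeBound; omega)]

lemma Settled.codeNum_eq (h : Φ.Settled s n (codeBound c e i)) (hs : s ≤ s') :
    Φ.codeNum c s n e i = Φ.codeNum c s' n e i := by
  unfold codeNum lateNum
  rw [Finset.sum_congr rfl fun j hj => by rw [h.late_eq hs (Finset.mem_range.1 hj).le]]

lemma Settled.codeword_eq (h : Φ.Settled s n (codeBound c e i)) (hs : s ≤ s') :
    Φ.codeword c s n e i = Φ.codeword c s' n e i := by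
  unfold codeword; rw [h.codeNum_eq hs]

end Machine

/-- Counting the times below `B` at which a predicate closed downwards holds gives the first
time at which it fails. -/
lemma sum_toNat_eq_find {P : ℕ → Bool} {B : ℕ} (hP : ∀ {t t'}, t ≤ t' → P t' = true → P t = true)
    (hB : P B = false) :
    P (∑ t ∈ Finset.range B, (P t).toNat) = false ∧
      ∀ t, P t = false → ∑ t ∈ Finset.range B, (P t).toNat ≤ t := by
  have hex : ∃ t, P t = false := ⟨B, hB⟩
  have hsum : ∑ t ∈ Finset.range B, (P t).toNat = Nat.find hex := by
    have hle := Nat.find_min' hex hB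
    have h2 : ∀ t, (P t).toNat = if t < Nat.find hex then 1 else 0 := fun t => by
      split_ifs with h
      · rw [Bool.of_not_eq_false (Nat.find_min hex h)]; rfl
      · cases ht : P t with
        | false => rfl
        | true =>
          have := hP (not_lt.1 h) ht
          rw [Nat.find_spec hex] at this
          cases this
    simp_rw [h2]
    rw [Finset.sum_boole, Nat.cast_id]
    have : (Finset.range B).filter (· < Nat.find hex) = Finset.range (Nat.find hex) := by
      ext t; simp only [Finset.mem_filter, Finset.mem_range]; omega
    rw [this, Finset.card_range]
  rw [hsum]
  exact ⟨Nat.find_spec hex, fun t ht => Nat.find_min' hex ht⟩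

namespace Machine

variable {Φ : Machine} {c s n e : ℕ}

lemma isEarly_eq_false_iff {B t : ℕ} : Φ.isEarly B n e t = false ↔
    Φ.partialOmega B B n ≤ Φ.partialOmega t B n + ((2 : ℝ) ^ (e + 1))⁻¹ := by
  have h2 : (0 : ℝ) < 2 ^ B := by positivity
  have h3 : (0 : ℝ) < 2 ^ (e + 1) := by positivity
  unfold isEarly
  rw [decide_eq_false_iff_not, not_lt, ← Nat.cast_le (α := ℝ)]
  push_cast
  rw [cast_omegaNum, cast_omegaNum,
    ← mul_le_mul_iff_right₀ (mul_pos h2 h3) (b := Φ.partialOmega B B n)]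
  have : (2 : ℝ) ^ B * 2 ^ (e + 1) * (Φ.partialOmega t B n + ((2 : ℝ) ^ (e + 1))⁻¹) =
      2 ^ B * Φ.partialOmega t B n * 2 ^ (e + 1) + 2 ^ B := by
    field_simp
  rw [this]
  constructor <;> intro h <;> linarith

lemma isEarly_cutTime : Φ.isEarly (Φ.bigTime c s n e) n e (Φ.cutTime c s n e) = false ∧
    ∀ t, Φ.isEarly (Φ.bigTime c s n e) n e t = false → Φ.cutTime c s n e ≤ t := by
  refine sum_toNat_eq_find (fun {t t'} h ht => ?_) ?_
  · by_contra h'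
    rw [Bool.not_eq_true, isEarly_eq_false_iff] at h'
    have h'' : ¬ Φ.isEarly (Φ.bigTime c s n e) n e t' = false := by simp [ht]
    rw [isEarly_eq_false_iff] at h''
    exact h'' (h'.trans (by gcongr; exact partialOmega_mono h le_rfl n))
  · rw [isEarly_eq_false_iff]
    exact le_add_of_nonneg_right (by positivity)

/-- The property of the constant provided by `POptimal.exists_time`. -/
def TimeConst (Φ : Machine) (c : ℕ) : Prop := ∀ n j m s₀ : ℕ,
    Φ.omegaReached s₀ j m n = true → ∃ s, ∃ i < 2 ^ (2 * Nat.pair j m + c + 2),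
      Φ.Outputs (strOfNat i) 0 n s ∧ Φ.omegaReached s j m n = true

lemma omegaReached_iff {j m : ℕ} : Φ.omegaReached s j m n = true ↔
    (m : ℝ) < Φ.partialOmega s s n * 2 ^ j + 1 := by
  have h2 : (0 : ℝ) < 2 ^ s := by positivity
  unfold omegaReached
  rw [decide_eq_true_eq, ← Nat.cast_lt (α := ℝ), ← mul_lt_mul_iff_right₀ h2 (b := (m : ℝ))]
  push_cast
  rw [cast_omegaNum]
  constructor <;> intro h <;> linarith

lemma Omega_le_partialOmega_bigTime (hpf : Φ.PrefixFree) (hc : Φ.TimeConst c)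
    (hs : Φ.Settled s n (idxBound c e)) :
    Φ.Omega n ≤ Φ.partialOmega (Φ.bigTime c s n e) (Φ.bigTime c s n e) n +
      ((2 : ℝ) ^ (e + 2))⁻¹ := by
  have h2 : (0 : ℝ) < 2 ^ (e + 3) := by positivity
  set m := ⌊Φ.Omega n * 2 ^ (e + 3)⌋₊ with hm
  have hm' : m ≤ 2 ^ (e + 3) := by
    refine Nat.floor_le_of_le ?_
    push_cast
    exact mul_le_of_le_one_left h2.le (Omega_le_one hpf n)
  obtain ⟨s₀, hs₀⟩ := exists_partialOmega_gt hpf n (inv_pos.2 h2)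
  have hfl : (m : ℝ) ≤ Φ.Omega n * 2 ^ (e + 3) :=
    Nat.floor_le (mul_nonneg (Omega_nonneg n) h2.le)
  obtain ⟨T, i, hi, hT, hr⟩ := hc n (e + 3) m s₀ (omegaReached_iff.2 (by
    rw [← sub_lt_iff_lt_add]
    have := mul_lt_mul_of_pos_right hs₀ h2
    rw [sub_mul, inv_mul_cancel₀ h2.ne'] at this
    linarith))
  have hi' : i < idxBound c e := by
    refine hi.trans_le (Nat.pow_le_pow_right (by simp) ?_)
    have : Nat.pair (e + 3) m ≤ Nat.pair (e + 3) (2 ^ (e + 3)) := by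
      rcases hm'.lt_or_eq with h | h
      · exact (Nat.pair_lt_pair_right _ h).le
      · rw [h]
    omega
  have hTB : T ≤ Φ.bigTime c s n e := by
    obtain ⟨v, hv⟩ := Option.isSome_iff_exists.1 (hs i hi' ⟨T, hT⟩)
    have : v = T := Outputs.unique ⟨s, hv⟩ hT
    calc T = (Φ.outAt s n i).getD 0 := by simp [hv, this]
      _ ≤ _ := Finset.single_le_sum (f := fun j => (Φ.outAt s n j).getD 0)
        (fun _ _ => Nat.zero_le _) (Finset.mem_range.2 hi')
  rw [omegaReached_iff] at hr
  have h4 : Φ.Omega n * 2 ^ (e + 3) < m + 1 := Nat.lt_floor_add_one _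
  have h5 := partialOmega_mono (Φ := Φ) hTB hTB n
  have h6 : Φ.Omega n < Φ.partialOmega T T n + ((2 : ℝ) ^ (e + 2))⁻¹ := by
    rw [← mul_lt_mul_iff_left₀ h2, add_mul]
    have : ((2 : ℝ) ^ (e + 2))⁻¹ * 2 ^ (e + 3) = 2 := by
      rw [pow_succ _ (e + 2)]; field_simp
    linarith
  linarith

lemma Omega_sub_OmegaT_cutTime_le (hpf : Φ.PrefixFree) (hc : Φ.TimeConst c)
    (hs : Φ.Settled s n (idxBound c e)) :
    Φ.Omega n - Φ.OmegaT n (Φ.cutTime c s n e) ≤ ((2 : ℝ) ^ e)⁻¹ := by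
  have h1 := isEarly_eq_false_iff.1 (isEarly_cutTime (Φ := Φ) (c := c) (s := s) (n := n) (e := e)).1
  have h2 := Omega_le_partialOmega_bigTime hpf hc hs
  have h3 : Φ.partialOmega (Φ.cutTime c s n e) (Φ.bigTime c s n e) n ≤ _ :=
    sum_haltWeight_le_OmegaT hpf (Φ.cutTime c s n e) n _
  have h4 : (0 : ℝ) < ((2 : ℝ) ^ e)⁻¹ := by positivity
  rw [pow_succ, mul_inv] at h1
  rw [pow_add, mul_inv] at h2
  norm_num at h1 h2
  linarith

lemma cutTime_le_tk (hpf : Φ.PrefixFree) : Φ.cutTime c s n e ≤ Φ.tk n (e + 2) := by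
  refine isEarly_cutTime.2 _ (isEarly_eq_false_iff.2 ?_)
  have h1 := Omega_sub_OmegaT_tk_le hpf n (e + 2)
  have h2 := sum_limWeight_sub_le hpf (Φ.tk n (e + 2)) n (Finset.range (Φ.bigTime c s n e))
  have h3 : Φ.partialOmega (Φ.bigTime c s n e) (Φ.bigTime c s n e) n ≤
      ∑ i ∈ Finset.range (Φ.bigTime c s n e), Φ.limWeight n i :=
    Finset.sum_le_sum fun i _ => haltWeight_le_limWeight _ n i
  rw [Finset.sum_sub_distrib] at h2
  rw [zpow_neg, zpow_natCast, pow_succ _ (e + 1), mul_inv] at h1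
  have h4 : (0 : ℝ) < ((2 : ℝ) ^ (e + 1))⁻¹ := by positivity
  unfold partialOmega at h3 ⊢
  linarith

/-- The late programs have measure at most `2 ^ (-e)`. -/
lemma sum_late_le (hpf : Φ.PrefixFree) (hc : Φ.TimeConst c)
    (hs : Φ.Settled s n (idxBound c e)) (S : Finset ℕ) :
    ∑ j ∈ S, (if Φ.late c s n e j = true then kraftWeight j else 0) ≤ ((2 : ℝ) ^ e)⁻¹ := by
  rcases Nat.eq_zero_or_pos e with he | he
  · refine le_trans (Finset.sum_le_sum (g := Φ.limWeight n) fun j _ => ?_)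
      ((sum_limWeight_le_one hpf n S).trans (by simp [he]))
    split_ifs with h
    · have : ∃ s, Φ.halted s n j = true := ⟨s, by
        simp only [late, Bool.and_eq_true] at h; exact h.1⟩
      rw [limWeight, if_pos this]
    · exact limWeight_nonneg n j
  · refine le_trans (Finset.sum_le_sum fun j _ => ?_)
      ((sum_limWeight_sub_le hpf (Φ.cutTime c s n e) n S).trans
        (Omega_sub_OmegaT_cutTime_le hpf hc hs))
    split_ifs with h
    · simp only [late, Bool.and_eq_true, Bool.or_eq_true, decide_eq_true_eq, he.ne', false_or,
        Bool.not_eq_true'] at h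
      have h1 : ∃ s, Φ.halted s n j = true := ⟨s, h.1⟩
      have h2 : ¬ Φ.halted (Φ.cutTime c s n e) n j = true := fun h' => by
        obtain ⟨v, -, hv⟩ := halted_iff.1 h'
        simp [hv] at h
      rw [limWeight, if_pos h1, haltWeight, if_neg h2, sub_zero]
    · exact sub_nonneg.2 (haltWeight_le_limWeight _ n j)

variable {i j : ℕ}

/-- The measure of the late programs of index less than `i`. -/
noncomputable def lateSum (Φ : Machine) (c s n e i : ℕ) : ℝ :=
  ∑ j ∈ Finset.range i, if Φ.late c s n e j = true then kraftWeight j else 0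

lemma cast_lateNum : (Φ.lateNum c s n e i : ℝ) = 2 ^ i * Φ.lateSum c s n e i := by
  unfold lateNum lateSum
  push_cast
  rw [Finset.mul_sum]
  refine Finset.sum_congr rfl fun j hj => ?_
  have : (strOfNat j).length ≤ i := (length_strOfNat_le j).trans (Finset.mem_range.1 hj).le
  split_ifs with h
  · rw [two_pow_mul_kraftWeight this, h]; simp
  · simp [h]

lemma lateSum_mono (h : i ≤ j) : Φ.lateSum c s n e i ≤ Φ.lateSum c s n e j :=
  Finset.sum_le_sum_of_subset_of_nonneg (Finset.range_mono h) fun k _ _ => by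
    split_ifs <;> simp [(kraftWeight_pos k).le]

lemma lateSum_succ (h : Φ.late c s n e i = true) :
    Φ.lateSum c s n e (i + 1) = Φ.lateSum c s n e i + kraftWeight i := by
  unfold lateSum; rw [Finset.sum_range_succ, if_pos h]

lemma lateSum_lt_codeNum : Φ.lateSum c s n e i < Φ.codeNum c s n e i * (kraftWeight i / 4) := by
  have h2 : (0 : ℝ) < 2 ^ ((strOfNat i).length + 2) := by positivity
  have hw : (2 : ℝ) ^ ((strOfNat i).length + 2) * (kraftWeight i / 4) = 1 := by
    have := two_pow_mul_kraftWeight (le_refl (strOfNat i).length)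
    rw [Nat.sub_self, pow_zero] at this
    rw [pow_add]; linarith
  have h := Nat.lt_div_mul_add (a := Φ.lateNum c s n e i * 2 ^ ((strOfNat i).length + 2))
    (b := 2 ^ i) (by positivity)
  rw [← Nat.succ_mul, ← Nat.cast_lt (α := ℝ)] at h
  push_cast at h
  rw [cast_lateNum] at h
  have h' : Φ.lateSum c s n e i * 2 ^ ((strOfNat i).length + 2) < Φ.codeNum c s n e i := by
    unfold codeNum
    push_cast
    refine lt_of_mul_lt_mul_right ?_ (show (0 : ℝ) ≤ 2 ^ i by positivity)
    linarith
  have h4 : 0 < kraftWeight i / 4 := by have := kraftWeight_pos i; positivity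
  have := mul_lt_mul_of_pos_right h' h4
  rwa [mul_assoc, hw, mul_one] at this

lemma codeNum_lt_lateSum :
    (Φ.codeNum c s n e i + 1) * (kraftWeight i / 4) < Φ.lateSum c s n e i + kraftWeight i := by
  have hw : (2 : ℝ) ^ ((strOfNat i).length + 2) * (kraftWeight i / 4) = 1 := by
    have := two_pow_mul_kraftWeight (le_refl (strOfNat i).length)
    rw [Nat.sub_self, pow_zero] at this
    rw [pow_add]; linarith
  have h := Nat.div_mul_le_self (Φ.lateNum c s n e i * 2 ^ ((strOfNat i).length + 2)) (2 ^ i)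
  rw [← Nat.cast_le (α := ℝ)] at h
  push_cast at h
  rw [cast_lateNum] at h
  have h' : (Φ.codeNum c s n e i : ℝ) ≤
      Φ.lateSum c s n e i * 2 ^ ((strOfNat i).length + 2) + 1 := by
    unfold codeNum
    push_cast
    gcongr
    refine le_of_mul_le_mul_right ?_ (show (0 : ℝ) < 2 ^ i by positivity)
    linarith
  have h4 := kraftWeight_pos i
  have := mul_le_mul_of_nonneg_right h' (show 0 ≤ kraftWeight i / 4 by positivity)
  rw [add_mul, mul_assoc, hw] at this
  linarith

lemma codeNum_mul_lt (hpf : Φ.PrefixFree) (hc : Φ.TimeConst c)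
    (hs : Φ.Settled s n (idxBound c e)) (h : Φ.late c s n e i = true) :
    Φ.codeNum c s n e i * 2 ^ e < 2 ^ ((strOfNat i).length + 2) := by
  have h1 := codeNum_lt_lateSum (Φ := Φ) (c := c) (s := s) (n := n) (e := e) (i := i)
  rw [← lateSum_succ h] at h1
  have h2 : Φ.lateSum c s n e (i + 1) ≤ _ := sum_late_le hpf hc hs (Finset.range (i + 1))
  have h3 := kraftWeight_pos i
  have h4 : (Φ.codeNum c s n e i : ℝ) * (kraftWeight i / 4) < ((2 : ℝ) ^ e)⁻¹ := by linarith
  have hw := two_pow_mul_kraftWeight (le_refl (strOfNat i).length)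
  rw [Nat.sub_self, pow_zero] at hw
  have h5 : (0 : ℝ) < 2 ^ e := by positivity
  rw [← Nat.cast_lt (α := ℝ)]
  push_cast
  refine lt_of_mul_lt_mul_right ?_ (show 0 ≤ kraftWeight i / 4 by positivity)
  have h6 := mul_lt_mul_of_pos_right h4 h5
  rw [inv_mul_cancel₀ h5.ne'] at h6
  rw [pow_add]
  linarith

lemma le_length_of_late (hpf : Φ.PrefixFree) (hc : Φ.TimeConst c)
    (hs : Φ.Settled s n (idxBound c e)) (h : Φ.late c s n e i = true) :
    e ≤ (strOfNat i).length := by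
  have h1 := sum_late_le hpf hc hs {i}
  rw [Finset.sum_singleton, if_pos h] at h1
  unfold kraftWeight at h1
  rw [zpow_neg, zpow_natCast, inv_le_inv₀ (by positivity) (by positivity)] at h1
  exact (pow_le_pow_iff_right₀ (by norm_num)).1 h1

lemma codeNum_lt (hpf : Φ.PrefixFree) (hc : Φ.TimeConst c)
    (hs : Φ.Settled s n (idxBound c e)) (h : Φ.late c s n e i = true) :
    Φ.codeNum c s n e i < 2 ^ ((strOfNat i).length + 2 - e) := by
  refine lt_of_mul_lt_mul_right ?_ (Nat.zero_le (2 ^ e))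
  have := le_length_of_late hpf hc hs h
  rw [← pow_add, Nat.sub_add_cancel (by omega)]
  exact codeNum_mul_lt hpf hc hs h

lemma length_codeword (hpf : Φ.PrefixFree) (hc : Φ.TimeConst c)
    (hs : Φ.Settled s n (idxBound c e)) (h : Φ.late c s n e i = true) :
    (Φ.codeword c s n e i).length =
      2 * Nat.log 2 (e + 1) + 1 + ((strOfNat i).length + 2 - e) := by
  unfold codeword
  rw [List.length_append, length_natCode, length_binStr (codeNum_lt hpf hc hs h)]

/-- Codewords of different late programs are not prefixes of each other. -/
lemma eq_of_codeword_prefix (hpf : Φ.PrefixFree) (hc : Φ.TimeConst c)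
    (hs : Φ.Settled s n (idxBound c e)) (hi : Φ.late c s n e i = true)
    (hj : Φ.late c s n e j = true)
    (hp : binStr ((strOfNat i).length + 2 - e) (Φ.codeNum c s n e i) <+:
      binStr ((strOfNat j).length + 2 - e) (Φ.codeNum c s n e j)) : i = j := by
  obtain ⟨hl, h1, h2⟩ := binStr_prefix (codeNum_lt hpf hc hs hi) (codeNum_lt hpf hc hs hj) hp
  have hei := le_length_of_late hpf hc hs hi
  have hej := le_length_of_late hpf hc hs hj
  have hwi := kraftWeight_pos i
  have hwj := kraftWeight_pos j
  set D := (strOfNat j).length + 2 - e - ((strOfNat i).length + 2 - e) with hD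
  have hw : (2 : ℝ) ^ D * kraftWeight j = kraftWeight i := by
    unfold kraftWeight
    rw [← zpow_natCast, ← zpow_add₀ two_ne_zero]
    congr 1
    omega
  rw [← Nat.cast_le (α := ℝ)] at h1
  rw [Nat.lt_iff_add_one_le, ← Nat.cast_le (α := ℝ)] at h2
  push_cast at h1 h2
  replace h1 := mul_le_mul_of_nonneg_right h1 (show 0 ≤ kraftWeight j / 4 by positivity)
  replace h2 := mul_le_mul_of_nonneg_right h2 (show 0 ≤ kraftWeight j / 4 by positivity)
  rw [mul_assoc, ← mul_div_assoc (2 ^ D), hw] at h1 h2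
  have li := lateSum_lt_codeNum (Φ := Φ) (c := c) (s := s) (n := n) (e := e) (i := i)
  have lj := lateSum_lt_codeNum (Φ := Φ) (c := c) (s := s) (n := n) (e := e) (i := j)
  have ui := codeNum_lt_lateSum (Φ := Φ) (c := c) (s := s) (n := n) (e := e) (i := i)
  have uj := codeNum_lt_lateSum (Φ := Φ) (c := c) (s := s) (n := n) (e := e) (i := j)
  rw [← lateSum_succ hi] at ui
  rw [← lateSum_succ hj] at uj
  rcases lt_trichotomy i j with h | h | h
  · have := lateSum_mono (Φ := Φ) (c := c) (s := s) (n := n) (e := e) (Nat.succ_le_of_lt h)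
    simp only [Nat.succ_eq_add_one] at this
    linarith
  · exact h
  · have := lateSum_mono (Φ := Φ) (c := c) (s := s) (n := n) (e := e) (Nat.succ_le_of_lt h)
    simp only [Nat.succ_eq_add_one] at this
    linarith

lemma oracleAgrees_iff {m J : ℕ} {w : List Bool} : Φ.oracleAgrees m s n J w = true ↔
    Nat.pair J n ≤ m ∧ ∀ j < J, w.getD (Nat.pair j n) false = (Φ.outAt s n j).isSome := by
  simp only [oracleAgrees, Bool.and_eq_true, decide_eq_true_eq, Finset.sum_eq_zero_iff,
    Finset.mem_range, Nat.lt_succ_iff, Bool.toNat_eq_zero,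
    Bool.not_eq_eq_eq_not, Bool.not_false]

lemma getD_oraclePrefix_Hseq {m J : ℕ} (h : Nat.pair J n ≤ m) (hj : j < J) :
    (oraclePrefix (Hseq Φ) m).getD (Nat.pair j n) false =
      decide (Φ.HaltsOn (strOfNat j) 0 n) := by
  rw [getD_oraclePrefix _ ((Nat.pair_lt_pair_left n hj).trans_le h)]
  simp [Hseq]

lemma settled_of_oracleAgrees {m J : ℕ}
    (h : Φ.oracleAgrees m s n J (oraclePrefix (Hseq Φ) m) = true) : Φ.Settled s n J := by
  obtain ⟨hm, h⟩ := oracleAgrees_iff.1 h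
  intro j hj hH
  rw [← h j hj, getD_oraclePrefix_Hseq hm hj]
  simpa using hH

lemma Settled.oracleAgrees {m J : ℕ} (h : Φ.Settled s n J) (hm : Nat.pair J n ≤ m) :
    Φ.oracleAgrees m s n J (oraclePrefix (Hseq Φ) m) = true := by
  refine oracleAgrees_iff.2 ⟨hm, fun j hj => ?_⟩
  rw [getD_oraclePrefix_Hseq hm hj, Bool.eq_iff_iff, decide_eq_true_eq]
  refine ⟨h j hj, fun h' => ?_⟩
  obtain ⟨v, hv⟩ := Option.isSome_iff_exists.1 h'
  exact ⟨v, s, hv⟩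

lemma codeSearch_eq_some {m v : ℕ} {p : List Bool}
    (h : Φ.codeSearch c m p n (oraclePrefix (Hseq Φ) m) = some v) :
    ∃ s e i, Φ.Settled s n (codeBound c e i) ∧ Φ.late c s n e i = true ∧
      p = Φ.codeword c s n e i ∧ Φ.outAt s n i = some v := by
  unfold codeSearch at h
  rw [Bool.cond_eq_ite] at h
  split_ifs at h with h'
  simp only [Bool.and_eq_true, decide_eq_true_eq] at h'
  exact ⟨_, _, _, settled_of_oracleAgrees h'.1.1, h'.1.2, h'.2, h⟩

lemma idxBound_le_codeBound : idxBound c e ≤ codeBound c e i := by unfold codeBound; omega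

lemma codeSearch_prefix (hpf : Φ.PrefixFree) (hc : Φ.TimeConst c) {m m' v v' : ℕ}
    {p p' : List Bool} (h : Φ.codeSearch c m p n (oraclePrefix (Hseq Φ) m) = some v)
    (h' : Φ.codeSearch c m' p' n (oraclePrefix (Hseq Φ) m') = some v') (hp : p <+: p') :
    p = p' ∧ v = v' := by
  obtain ⟨s, e, i, hs, hl, rfl, hv⟩ := codeSearch_eq_some h
  obtain ⟨s', e', i', hs', hl', rfl, hv'⟩ := codeSearch_eq_some h'
  have h1 := hs.codeword_eq (le_max_left s s')
  have h1' := hs'.codeword_eq (le_max_right s s')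
  rw [hs.late_eq (le_max_left s s') le_rfl] at hl
  rw [hs'.late_eq (le_max_right s s') le_rfl] at hl'
  rw [h1, h1'] at hp ⊢
  obtain ⟨rfl, hp'⟩ := natCode_append_prefix hp
  obtain rfl := eq_of_codeword_prefix hpf hc
    (hs.mono (le_max_left s s') idxBound_le_codeBound) hl hl' hp'
  exact ⟨rfl, Outputs.unique ⟨s, hv⟩ ⟨s', hv'⟩⟩

/-- The programs that are late for a settled time are decoded from their codewords, given the
halting sequence. -/
lemma search_codeSearch_outputs (hpf : Φ.PrefixFree) (hc : Φ.TimeConst c) {v y : ℕ}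
    (hs : Φ.Settled s n (codeBound c e i)) (hl : Φ.late c s n e i = true)
    (hv : Φ.outAt s n i = some v) :
    (OracleMachine.search (Φ.codeSearch c) (Φ.computable_codeSearch c)).Outputs (Hseq Φ)
      (Φ.codeword c s n e i) y n v := by
  set s' := max s (Nat.pair (codeBound c e i) n)
  have hss : s ≤ s' := le_max_left _ _
  set m := Nat.pair s' (Nat.pair e i) with hm
  have hG : Φ.codeSearch c m (Φ.codeword c s n e i) n (oraclePrefix (Hseq Φ) m) = some v := by
    unfold codeSearch
    simp only [hm, Nat.unpair_pair]
    rw [← hm, (hs.mono hss le_rfl).oracleAgrees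
      ((le_max_right _ _).trans (Nat.left_le_pair _ _)), ← hs.late_eq hss le_rfl, hl,
      ← hs.codeword_eq hss, outAt_mono hss hv]
    simp
  obtain ⟨v', hv'⟩ := OracleMachine.search_haltsOn (y := y) (hG := Φ.computable_codeSearch c)
    (Option.isSome_iff_exists.2 ⟨v, hG⟩)
  obtain ⟨m', hm'⟩ := OracleMachine.exists_of_search_outputs hv'
  rwa [(codeSearch_prefix hpf hc hG hm' List.prefix_rfl).2]

lemma late_of_mdepth (hpf : Φ.PrefixFree) {d x : ℕ} (hx : x < 2 ^ n)
    (hv : Φ.outAt s n i = some x) (hi : (strOfNat i).length = Φ.C x 0 n) :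
    Φ.late c s n (Φ.mdepth d n x - 3) i = true := by
  simp only [late, Bool.and_eq_true, Bool.or_eq_true, decide_eq_true_eq, Bool.not_eq_true',
    halted_iff]
  refine ⟨⟨x, hx, hv⟩, or_iff_not_imp_left.2 fun he => ?_⟩
  by_contra hne
  rw [Bool.not_eq_false] at hne
  obtain ⟨v, hv'⟩ := Option.isSome_iff_exists.1 hne
  obtain rfl : v = x := Outputs.unique ⟨_, hv'⟩ ⟨s, hv⟩
  have hk : Φ.mdepth d n v - 3 + 2 < Φ.mdepth d n v := by omega
  exact Nat.notMem_of_lt_sInf hk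
    ⟨strOfNat i, by omega, outAt_mono (cutTime_le_tk hpf) hv'⟩

end Machine

/-- `I(x;H) ≥ k_x − 2 log k_x − O(1)`. -/
theorem stmt_4 (Φ : Machine) (hΦ : Φ.POptimal) (MH : OracleMachine)
    (hMH : MH.POptimal (Hseq Φ)) (d : ℕ) :
    ∃ c : ℕ, ∀ n : ℕ, ∀ x < 2 ^ n,
      (Φ.mdepth d n x : ℤ) - 2 * Nat.log 2 (Φ.mdepth d n x) - c ≤
        (Φ.C x 0 n : ℤ) - (MH.C (Hseq Φ) x 0 n : ℤ) := by
  obtain ⟨c, hc⟩ : ∃ c, Φ.TimeConst c := hΦ.exists_time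
  have hpf : Φ.PrefixFree := hΦ.1
  obtain ⟨cN, hN⟩ := hMH.2.2
    (OracleMachine.search (Φ.codeSearch c) (Φ.computable_codeSearch c)) (by
      rintro p q y n ⟨v, hv⟩ ⟨v', hv'⟩ hpq
      obtain ⟨m, hm⟩ := OracleMachine.exists_of_search_outputs hv
      obtain ⟨m', hm'⟩ := OracleMachine.exists_of_search_outputs hv'
      exact (Machine.codeSearch_prefix hpf hc hm hm' hpq).1)
  refine ⟨cN + 6, fun n x hx => ?_⟩
  obtain ⟨p, ⟨t, ht⟩, hlen⟩ := hΦ.2.1.exists_shortestProg x 0 n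
  obtain ⟨i, -, rfl⟩ := exists_strOfNat_eq p
  set k := Φ.mdepth d n x
  obtain ⟨s₀, hs₀⟩ := Machine.exists_settled (Φ := Φ) n (Machine.codeBound c (k - 3) i)
  have hs := hs₀.mono (le_max_left s₀ t) le_rfl
  have hv : Φ.outAt (max s₀ t) n i = some x := Machine.outAt_mono (le_max_right s₀ t) ht
  have hs' := hs.mono le_rfl Machine.idxBound_le_codeBound
  have hl := Machine.late_of_mdepth (c := c) (d := d) hpf hx hv hlen
  have hC := hN _ _ _ _ (Machine.search_codeSearch_outputs (y := 0) hpf hc hs hl hv)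
  have he := Machine.le_length_of_late hpf hc hs' hl
  rw [Machine.length_codeword hpf hc hs' hl, hlen] at hC
  rw [hlen] at he
  have hlog : Nat.log 2 (k - 3 + 1) ≤ Nat.log 2 k := by
    rcases Nat.eq_zero_or_pos k with h | h
    · simp [h]
    · exact Nat.log_mono_right (by omega)
  omega
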